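/- arXiv:1908.01388 — 2 statements merged into one kernel-verified Lean document; each statement's English description precedes it below -/
import Mathlib

section
/- Let (X,c) be a complete separable metric space with at least two points (so that the metric c is a symmetric cost function). Then r*_c(P(X)) = 1 if and only if (X,c) can be isometrically embedded into ℝ with the metric (x,y) ↦ |x − y|, i.e., if and only if there exists a function g : X → ℝ such that c(x,y) = |g(x) − g(y)| for all x, y ∈ X. -/
open MeasureTheory ENNReal

noncomputable section

/-- The optimal transport cost `C*_c(P,Q)` between two Borel measures for the cost `c`:
the infimum of `∫ c dγ` over couplings `γ` of `(P, Q)`. -/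
def Cstar {X : Type*} [MeasurableSpace X] (c : X → X → ℝ) (P Q : Measure X) : ℝ≥0∞ :=
  ⨅ γ ∈ {γ : Measure (X × X) |
      IsProbabilityMeasure γ ∧ γ.map Prod.fst = P ∧ γ.map Prod.snd = Q},
    ∫⁻ z, ENNReal.ofReal (c z.1 z.2) ∂γ

/-- The standard probability space: `[0,1]` with Lebesgue measure. -/
def stdSpace : Measure ℝ := volume.restrict (Set.Icc (0 : ℝ) 1)

/-- `f` is a coupling of the family of probability measures `P` on the standard
probability space `([0,1], Lebesgue)`: each `f a` is measurable with law `P a`. -/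
structure IsCoupling {X A : Type*} [MeasurableSpace X]
    (P : A → Measure X) (f : A → ℝ → X) : Prop where
  measurable : ∀ a, Measurable (f a)
  law : ∀ a, stdSpace.map (f a) = P a

/-- The pairwise coupling ratio `r_c({X_α})` of a coupling `f` of the family `P`:
the least `r ≥ 1` such that `E[c(X_a, X_b)] ≤ r ⬝ C*_c(P_a, P_b)` for all `a, b`
(`∞` if no such `r` exists). -/
def couplingRatio {X A : Type*} [MeasurableSpace X]
    (c : X → X → ℝ) (P : A → Measure X) (f : A → ℝ → X) : ℝ≥0∞ :=
  sInf {r : ℝ≥0∞ | 1 ≤ r ∧ ∀ a b : A,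
    ∫⁻ u, ENNReal.ofReal (c (f a u) (f b u)) ∂stdSpace ≤ r * Cstar c (P a) (P b)}

/-- The optimal pairwise coupling ratio `r*_c({P_α})` of a family of probability
measures: the infimum of `r_c({X_α})` over all couplings of the family. -/
def optRatio {X A : Type*} [MeasurableSpace X]
    (c : X → X → ℝ) (P : A → Measure X) : ℝ≥0∞ :=
  ⨅ (f : A → ℝ → X) (_ : IsCoupling P f), couplingRatio c P f

section Quantile

open ProbabilityTheory Set

/-- The quantile function of a measure on `ℝ`, set to `0` outside `(0, 1)`. -/
def quantile (P : Measure ℝ) (u : ℝ) : ℝ :=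
  open Classical in if u ∈ Ioo (0 : ℝ) 1 then sInf {x | u ≤ cdf P x} else 0

lemma quantile_le_iff (P : Measure ℝ) {u : ℝ} (hu : u ∈ Ioo (0 : ℝ) 1) (x : ℝ) :
    quantile P u ≤ x ↔ u ≤ cdf P x := by
  rw [quantile, if_pos hu]
  have hne : {x | u ≤ cdf P x}.Nonempty := by
    obtain ⟨y, hy⟩ := ((tendsto_cdf_atTop P).eventually (lt_mem_nhds hu.2)).exists
    exact ⟨y, hy.le⟩
  have hbdd : BddBelow {x | u ≤ cdf P x} := by
    obtain ⟨y, hy⟩ := ((tendsto_cdf_atBot P).eventually (gt_mem_nhds hu.1)).exists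
    refine ⟨y, fun z hz => ?_⟩
    by_contra! h
    exact absurd (hz.trans (monotone_cdf P h.le)) (not_le.2 hy)
  refine ⟨fun h => ?_, fun h => csInf_le hbdd h⟩
  have hlt : ∀ y, x < y → u ≤ cdf P y := by
    intro y hy
    obtain ⟨z, hz, hzy⟩ := exists_lt_of_csInf_lt hne (h.trans_lt hy)
    exact hz.trans (monotone_cdf P hzy.le)
  have hcont : Filter.Tendsto (cdf P) (nhdsWithin x (Ioi x)) (nhds (cdf P x)) :=
    ((cdf P).right_continuous x).mono Ioi_subset_Ici_self
  exact ge_of_tendsto hcont (Filter.eventually_of_mem self_mem_nhdsWithin hlt)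

lemma measurable_quantile (P : Measure ℝ) : Measurable (quantile P) := by
  refine measurable_of_Iic fun x => ?_
  have : quantile P ⁻¹' Iic x = (Ioo 0 1 ∩ Iic (cdf P x)) ∪ ((Ioo 0 1)ᶜ ∩ {_u | (0 : ℝ) ≤ x}) := by
    ext u
    by_cases hu : u ∈ Ioo (0 : ℝ) 1
    · simp only [mem_preimage, mem_Iic, quantile_le_iff P hu, mem_union, mem_inter_iff, hu,
        mem_compl_iff, not_true, false_and, or_false, true_and]
    · simp only [mem_preimage, mem_Iic, quantile, if_false, mem_union, mem_inter_iff, hu,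
        mem_compl_iff, not_false_iff, false_and, false_or, true_and, mem_ofPred_eq]
  rw [this]
  exact (measurableSet_Ioo.inter measurableSet_Iic).union
    (measurableSet_Ioo.compl.inter (MeasurableSet.const _))

instance : IsProbabilityMeasure stdSpace := ⟨by simp [stdSpace]⟩

lemma ae_stdSpace_mem_Ioo : ∀ᵐ u ∂stdSpace, u ∈ Ioo (0 : ℝ) 1 := by
  rw [stdSpace, ← restrict_Ioo_eq_restrict_Icc]
  exact ae_restrict_mem measurableSet_Ioo

lemma quantile_preimage_Iic_ae_eq (P : Measure ℝ) (x : ℝ) :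
    quantile P ⁻¹' Iic x =ᵐ[stdSpace] Iic (cdf P x) := by
  filter_upwards [ae_stdSpace_mem_Ioo] with u hu
  exact propext (quantile_le_iff P hu x)

lemma map_quantile (P : Measure ℝ) [IsProbabilityMeasure P] :
    stdSpace.map (quantile P) = P := by
  have : IsProbabilityMeasure (stdSpace.map (quantile P)) :=
    Measure.isProbabilityMeasure_map (measurable_quantile P).aemeasurable
  refine Measure.ext_of_Iic _ _ fun x => ?_
  rw [Measure.map_apply (measurable_quantile P) measurableSet_Iic,
    measure_congr (quantile_preimage_Iic_ae_eq P x), stdSpace,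
    Measure.restrict_apply measurableSet_Iic, ← ofReal_cdf P x]
  have : Iic (cdf P x) ∩ Icc 0 1 = Icc 0 (cdf P x) := by
    ext u
    have := cdf_le_one P x
    simp only [mem_inter_iff, mem_Iic, mem_Icc]
    constructor
    · rintro ⟨h, h', -⟩; exact ⟨h', h⟩
    · rintro ⟨h', h⟩; exact ⟨h, h', h.trans this⟩
  rw [this, Real.volume_Icc, sub_zero]

lemma lintegral_abs_sub_eq {Ω : Type*} [MeasurableSpace Ω] (μ : Measure Ω) [SFinite μ]
    {U V : Ω → ℝ} (hU : Measurable U) (hV : Measurable V) :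
    ∫⁻ ω, ENNReal.ofReal |U ω - V ω| ∂μ =
      ∫⁻ x : ℝ, (μ (U ⁻¹' Iic x \ V ⁻¹' Iic x) + μ (V ⁻¹' Iic x \ U ⁻¹' Iic x)) := by
  have hS : ∀ {U V : Ω → ℝ}, Measurable U → Measurable V →
      MeasurableSet {z : Ω × ℝ | U z.1 ≤ z.2 ∧ z.2 < V z.1} := fun hU hV =>
    (measurableSet_le (hU.comp measurable_fst) measurable_snd).inter
      (measurableSet_lt measurable_snd (hV.comp measurable_fst))
  have key : ∀ {U V : Ω → ℝ}, Measurable U → Measurable V →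
      ∫⁻ ω, ENNReal.ofReal (V ω - U ω) ∂μ = ∫⁻ x : ℝ, μ (U ⁻¹' Iic x \ V ⁻¹' Iic x) := by
    intro U V hU hV
    have h1 := Measure.prod_apply (μ := μ) (ν := (volume : Measure ℝ)) (hS hU hV)
    have h2 := Measure.prod_apply_symm (μ := μ) (ν := (volume : Measure ℝ)) (hS hU hV)
    rw [h1] at h2
    convert h2 using 1
    · exact lintegral_congr fun ω => by rw [← Real.volume_Ico]; rfl
    · refine lintegral_congr fun x => congrArg μ ?_
      ext ω
      simp
  rw [lintegral_add_left', ← key hU hV, ← key hV hU, ← lintegral_add_left]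
  · refine lintegral_congr fun ω => ?_
    rcases le_total (U ω) (V ω) with h | h
    · rw [abs_sub_comm, abs_of_nonneg (sub_nonneg.2 h),
        ENNReal.ofReal_of_nonpos (sub_nonpos.2 h), add_zero]
    · rw [abs_of_nonneg (sub_nonneg.2 h), ENNReal.ofReal_of_nonpos (sub_nonpos.2 h), zero_add]
  · exact (hV.sub hU).ennreal_ofReal
  · refine (measurable_measure_prodMk_right (μ := μ) (hS hU hV)).aemeasurable.congr
      (.of_forall fun x => congrArg μ ?_)
    ext ω
    simp

lemma lintegral_quantile_le {Ω : Type*} [MeasurableSpace Ω] (γ : Measure Ω)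
    [IsProbabilityMeasure γ] {U V : Ω → ℝ} (hU : Measurable U) (hV : Measurable V) :
    ∫⁻ u, ENNReal.ofReal |quantile (γ.map U) u - quantile (γ.map V) u| ∂stdSpace ≤
      ∫⁻ ω, ENNReal.ofReal |U ω - V ω| ∂γ := by
  have key : ∀ {U V : Ω → ℝ}, Measurable U → Measurable V → ∀ x : ℝ,
      stdSpace (quantile (γ.map U) ⁻¹' Iic x \ quantile (γ.map V) ⁻¹' Iic x) ≤
        γ (U ⁻¹' Iic x \ V ⁻¹' Iic x) := by
    intro U V hU hV x
    have := Measure.isProbabilityMeasure_map (μ := γ) hU.aemeasurable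
    have := Measure.isProbabilityMeasure_map (μ := γ) hV.aemeasurable
    have hlaw : ∀ {W : Ω → ℝ}, Measurable W →
        stdSpace (Iic (cdf (γ.map W) x)) = γ (W ⁻¹' Iic x) := by
      intro W hW
      have := Measure.isProbabilityMeasure_map (μ := γ) hW.aemeasurable
      rw [← measure_congr (quantile_preimage_Iic_ae_eq (γ.map W) x),
        ← Measure.map_apply (measurable_quantile _) measurableSet_Iic, map_quantile,
        Measure.map_apply hW measurableSet_Iic]
    rw [measure_congr ((quantile_preimage_Iic_ae_eq (γ.map U) x).diff
      (quantile_preimage_Iic_ae_eq (γ.map V) x))]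
    rcases le_total (cdf (γ.map U) x) (cdf (γ.map V) x) with h | h
    · rw [sdiff_eq_empty.2 (Iic_subset_Iic.2 h), measure_empty]
      exact zero_le
    · rw [measure_sdiff (Iic_subset_Iic.2 h) measurableSet_Iic.nullMeasurableSet
        (measure_ne_top _ _), hlaw hU, hlaw hV]
      exact le_measure_sdiff
  rw [lintegral_abs_sub_eq _ (measurable_quantile _) (measurable_quantile _),
    lintegral_abs_sub_eq _ hU hV]
  exact lintegral_mono fun x => add_le_add (key hU hV x) (key hV hU x)

end Quantile

lemma one_le_optRatio {X A : Type*} [MeasurableSpace X] (c : X → X → ℝ) (P : A → Measure X) :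
    1 ≤ optRatio c P :=
  le_iInf₂ fun _ _ => le_sInf fun _ hr => hr.1

/-- The quantile coupling is optimal for all pairs at once on a closed subset of the line. -/
lemma optRatio_le_one_of_isometry {X : Type*} [MetricSpace X] [CompleteSpace X] [Nonempty X]
    [MeasurableSpace X] [BorelSpace X] {g : X → ℝ} (hg : Isometry g) :
    optRatio (fun x y : X => dist x y)
      (fun P : ProbabilityMeasure X => (P : Measure X)) ≤ 1 := by
  have hemb : MeasurableEmbedding g := hg.isClosedEmbedding.measurableEmbedding
  have hgm : Measurable g := hemb.measurable
  obtain ⟨h, hhm, hh⟩ := hemb.exists_measurable_extend measurable_id (fun _ => ‹Nonempty X›)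
  have hhg : ∀ x, h (g x) = x := congrFun hh
  have hprob : ∀ P : ProbabilityMeasure X, IsProbabilityMeasure ((P : Measure X).map g) :=
    fun P => Measure.isProbabilityMeasure_map hgm.aemeasurable
  have hgh : ∀ P : ProbabilityMeasure X,
      ∀ᵐ u ∂stdSpace, g (h (quantile ((P : Measure X).map g) u)) =
        quantile ((P : Measure X).map g) u := by
    intro P
    have := hprob P
    have h1 : ∀ᵐ y ∂((P : Measure X).map g), g (h y) = y :=
      (ae_map_iff hgm.aemeasurable
        (measurableSet_eq_fun (hgm.comp hhm) measurable_id)).2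
        (Filter.Eventually.of_forall fun x => congrArg g (hhg x))
    rw [← map_quantile ((P : Measure X).map g)] at h1
    exact ae_of_ae_map (measurable_quantile _).aemeasurable h1
  refine iInf₂_le_of_le (fun P u => h (quantile ((P : Measure X).map g) u))
    ⟨fun P => hhm.comp (measurable_quantile _), fun P => ?_⟩ (sInf_le ⟨le_rfl, fun P Q => ?_⟩)
  · have := hprob P
    change stdSpace.map (h ∘ quantile ((P : Measure X).map g)) = _
    rw [← Measure.map_map hhm (measurable_quantile _), map_quantile,
      Measure.map_map hhm hgm, hh, Measure.map_id]
  · rw [one_mul]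
    refine le_iInf₂ fun γ ⟨hγ, hP, hQ⟩ => ?_
    have hPm : (P : Measure X).map g = γ.map (g ∘ Prod.fst) := by
      rw [← show γ.map Prod.fst = P from hP, Measure.map_map hgm measurable_fst]
    have hQm : (Q : Measure X).map g = γ.map (g ∘ Prod.snd) := by
      rw [← show γ.map Prod.snd = Q from hQ, Measure.map_map hgm measurable_snd]
    calc _ = ∫⁻ u, ENNReal.ofReal |quantile ((P : Measure X).map g) u -
            quantile ((Q : Measure X).map g) u| ∂stdSpace := by
          refine lintegral_congr_ae ?_
          filter_upwards [hgh P, hgh Q] with u hu hv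
          rw [← hg.dist_eq, hu, hv, Real.dist_eq]
      _ ≤ ∫⁻ z, ENNReal.ofReal |g z.1 - g z.2| ∂γ := by
          rw [hPm, hQm]
          exact lintegral_quantile_le γ (hgm.comp measurable_fst) (hgm.comp measurable_snd)
      _ = _ := by simp only [← hg.dist_eq, Real.dist_eq]

section TwoPoint

/-- The uniform distribution on an ordered pair of points. -/
def pairMeasure {Y : Type*} [MeasurableSpace Y] (p : Y × Y) : Measure Y :=
  (2⁻¹ : ℝ≥0∞) • Measure.dirac p.1 + (2⁻¹ : ℝ≥0∞) • Measure.dirac p.2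

instance {Y : Type*} [MeasurableSpace Y] (p : Y × Y) : IsProbabilityMeasure (pairMeasure p) :=
  ⟨by simp [pairMeasure, ENNReal.inv_two_add_inv_two]⟩

lemma pairMeasure_swap {Y : Type*} [MeasurableSpace Y] (p : Y × Y) :
    pairMeasure p.swap = pairMeasure p := by
  simp [pairMeasure, add_comm]

/-- `pairMeasure` bundled as a probability measure. -/
def pairProb {Y : Type*} [MeasurableSpace Y] (p : Y × Y) : ProbabilityMeasure Y :=
  ⟨pairMeasure p, inferInstance⟩

variable {X : Type*} [MetricSpace X] [MeasurableSpace X]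

/-- `f` couples all probability measures on `X`, with pairwise ratio at most `1 + ε`. -/
def IsNearOptimal (ε : ℝ) (f : ProbabilityMeasure X → ℝ → X) : Prop :=
  IsCoupling (fun P : ProbabilityMeasure X => (P : Measure X)) f ∧
    ∀ P Q : ProbabilityMeasure X, ∫⁻ u, ENNReal.ofReal (dist (f P u) (f Q u)) ∂stdSpace ≤
      ENNReal.ofReal (1 + ε) * Cstar (fun x y : X => dist x y) P Q

lemma exists_isNearOptimal (h : optRatio (fun x y : X => dist x y)
    (fun P : ProbabilityMeasure X => (P : Measure X)) = 1) {ε : ℝ} (hε : 0 < ε) :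
    ∃ f : ProbabilityMeasure X → ℝ → X, IsNearOptimal ε f := by
  have hlt : optRatio (fun x y : X => dist x y)
      (fun P : ProbabilityMeasure X => (P : Measure X)) < ENNReal.ofReal (1 + ε) := by
    rw [h, ← ENNReal.ofReal_one]
    exact (ENNReal.ofReal_lt_ofReal_iff (by linarith)).2 (by linarith)
  obtain ⟨f, hf⟩ := iInf_lt_iff.1 hlt
  obtain ⟨hc, hf⟩ := iInf_lt_iff.1 hf
  obtain ⟨r, ⟨-, hr⟩, hlt⟩ := sInf_lt_iff.1 hf
  exact ⟨f, hc, fun P Q => (hr P Q).trans (by gcongr)⟩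

/-- The event that the coupled two-point variable of `p` takes the value `p.1`. -/
def fstEvent (f : ProbabilityMeasure X → ℝ → X) (p : X × X) : Set ℝ := f (pairProb p) ⁻¹' {p.1}

/-- Nearly optimal couplings nearly match first points with first points. -/
def Linked (p q : X × X) : Prop :=
  ∃ K : ℝ, ∀ ε > 0, ∀ f : ProbabilityMeasure X → ℝ → X, IsNearOptimal ε f →
    stdSpace.real (symmDiff (fstEvent f p) (fstEvent f q)) ≤ K * ε

lemma Linked.trans {p q r : X × X} (hpq : Linked p q) (hqr : Linked q r) : Linked p r := by
  obtain ⟨K, hK⟩ := hpq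
  obtain ⟨L, hL⟩ := hqr
  refine ⟨K + L, fun ε hε f hf => ?_⟩
  have := measureReal_mono (μ := stdSpace)
    (symmDiff_triangle (fstEvent f p) (fstEvent f q) (fstEvent f r))
  have h2 := measureReal_union_le (μ := stdSpace) (symmDiff (fstEvent f p) (fstEvent f q))
    (symmDiff (fstEvent f q) (fstEvent f r))
  have h3 := hK ε hε f hf
  have h4 := hL ε hε f hf
  simp only [Set.sup_eq_union] at this
  linarith

lemma setLIntegral_dist_eq {f : ProbabilityMeasure X → ℝ → X} {P Q : ProbabilityMeasure X}
    {S : Set ℝ} (hS : MeasurableSet S) {x y : X} (hx : ∀ᵐ u ∂stdSpace, u ∈ S → f P u = x)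
    (hy : ∀ᵐ u ∂stdSpace, u ∈ S → f Q u = y) :
    ∫⁻ u in S, ENNReal.ofReal (dist (f P u) (f Q u)) ∂stdSpace =
      ENNReal.ofReal (dist x y * stdSpace.real S) := by
  rw [ENNReal.ofReal_mul dist_nonneg, ofReal_measureReal, ← setLIntegral_const]
  refine setLIntegral_congr_fun_ae hS ?_
  filter_upwards [hx, hy] with u hu hv hS
  rw [hu hS, hv hS]

variable [BorelSpace X]

lemma Cstar_pairMeasure_le [TopologicalSpace.SeparableSpace X] (p q : X × X) :
    Cstar (fun x y : X => dist x y) (pairMeasure p) (pairMeasure q) ≤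
      ENNReal.ofReal ((dist p.1 q.1 + dist p.2 q.2) / 2) := by
  refine iInf₂_le_of_le (pairMeasure ((p.1, q.1), (p.2, q.2)))
    ⟨inferInstance, ?_, ?_⟩ (le_of_eq ?_)
  · simp [pairMeasure, Measure.map_add _ _ measurable_fst, Measure.map_dirac' measurable_fst]
  · simp [pairMeasure, Measure.map_add _ _ measurable_snd, Measure.map_dirac' measurable_snd]
  · rw [pairMeasure, lintegral_add_measure, lintegral_smul_measure, lintegral_smul_measure,
      lintegral_dirac, lintegral_dirac, ← smul_add, ← ENNReal.ofReal_add dist_nonneg dist_nonneg,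
      ENNReal.ofReal_div_of_pos two_pos, ENNReal.ofReal_ofNat, smul_eq_mul, ENNReal.div_eq_inv_mul]

lemma measurableSet_fstEvent {f : ProbabilityMeasure X → ℝ → X} {ε : ℝ} (hf : IsNearOptimal ε f)
    (p : X × X) : MeasurableSet (fstEvent f p) :=
  hf.1.measurable _ (measurableSet_singleton _)

lemma measureReal_fstEvent {f : ProbabilityMeasure X → ℝ → X} {ε : ℝ} (hf : IsNearOptimal ε f)
    {p : X × X} (hp : p.1 ≠ p.2) : stdSpace.real (fstEvent f p) = 1 / 2 := by
  have h := hf.1.law (pairProb p)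
  have h2 : stdSpace (fstEvent f p) = pairMeasure p {p.1} := by
    rw [fstEvent, ← Measure.map_apply (hf.1.measurable _) (measurableSet_singleton _), h]
    rfl
  rw [measureReal_def, h2]
  simp [pairMeasure, hp.symm]

lemma ae_eq_snd {f : ProbabilityMeasure X → ℝ → X} {ε : ℝ} (hf : IsNearOptimal ε f)
    (p : X × X) : ∀ᵐ u ∂stdSpace, u ∉ fstEvent f p → f (pairProb p) u = p.2 := by
  have h1 : ∀ᵐ x ∂(stdSpace.map (f (pairProb p))), x ≠ p.1 → x = p.2 := by
    rw [hf.1.law (pairProb p)]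
    change ∀ᵐ x ∂(pairMeasure p), x ≠ p.1 → x = p.2
    rw [ae_iff, pairMeasure]
    simp
  exact ae_of_ae_map (hf.1.measurable _).aemeasurable h1

lemma lintegral_dist_pairProb {f : ProbabilityMeasure X → ℝ → X} {ε : ℝ}
    (hf : IsNearOptimal ε f) (p q : X × X) :
    ∫⁻ u, ENNReal.ofReal (dist (f (pairProb p) u) (f (pairProb q) u)) ∂stdSpace =
      ENNReal.ofReal (dist p.1 q.1 * stdSpace.real (fstEvent f p ∩ fstEvent f q) +
        dist p.1 q.2 * stdSpace.real (fstEvent f p \ fstEvent f q) +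
        dist p.2 q.1 * stdSpace.real (fstEvent f q \ fstEvent f p) +
        dist p.2 q.2 * stdSpace.real (fstEvent f p ∪ fstEvent f q)ᶜ) := by
  have hA := measurableSet_fstEvent hf p
  have hB := measurableSet_fstEvent hf q
  have hp := ae_eq_snd hf p
  have hq := ae_eq_snd hf q
  rw [← lintegral_add_compl _ hA, ← lintegral_inter_add_sdiff _ (fstEvent f p) hB,
    ← lintegral_inter_add_sdiff _ (fstEvent f p)ᶜ hB, add_assoc (_ + _ : ℝ),
    ENNReal.ofReal_add (by positivity) (by positivity),
    ENNReal.ofReal_add (by positivity) (by positivity),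
    ENNReal.ofReal_add (by positivity) (by positivity),
    Set.inter_comm (fstEvent f p)ᶜ, ← Set.sdiff_eq, Set.sdiff_eq (fstEvent f p)ᶜ,
    ← Set.compl_union]
  congr 2
  · exact setLIntegral_dist_eq (hA.inter hB) (.of_forall fun u hu => hu.1)
      (.of_forall fun u hu => hu.2)
  · exact setLIntegral_dist_eq (hA.diff hB) (.of_forall fun u hu => hu.1)
      (hq.mono fun u hu h => hu h.2)
  · exact setLIntegral_dist_eq (hB.diff hA) (hp.mono fun u hu h => hu h.2)
      (.of_forall fun u hu => hu.1)
  · exact setLIntegral_dist_eq (hA.union hB).compl (hp.mono fun u hu h => hu fun h' => h (.inl h'))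
      (hq.mono fun u hu h => hu fun h' => h (.inr h'))

lemma linked_of_lt [TopologicalSpace.SeparableSpace X] {p q : X × X} (hp : p.1 ≠ p.2)
    (hq : q.1 ≠ q.2)
    (h : dist p.1 q.1 + dist p.2 q.2 < dist p.1 q.2 + dist p.2 q.1) : Linked p q := by
  refine ⟨(dist p.1 q.1 + dist p.2 q.2) /
    (dist p.1 q.2 + dist p.2 q.1 - (dist p.1 q.1 + dist p.2 q.2)), fun ε hε f hf => ?_⟩
  have hA := measurableSet_fstEvent hf p
  have hB := measurableSet_fstEvent hf q
  have hcost : ∫⁻ u, ENNReal.ofReal (dist (f (pairProb p) u) (f (pairProb q) u)) ∂stdSpace ≤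
      ENNReal.ofReal ((1 + ε) * ((dist p.1 q.1 + dist p.2 q.2) / 2)) := by
    rw [ENNReal.ofReal_mul (by linarith)]
    exact (hf.2 _ _).trans (mul_le_mul_right (Cstar_pairMeasure_le p q) _)
  rw [lintegral_dist_pairProb hf, ENNReal.ofReal_le_ofReal_iff (by positivity)] at hcost
  have hdiff := measureReal_inter_add_sdiff (μ := stdSpace) (s := fstEvent f p) hB
  have hdiff' := measureReal_inter_add_sdiff (μ := stdSpace) (s := fstEvent f q) hA
  have hcompl := measureReal_compl (μ := stdSpace) (hA.union hB)
  have hunion := measureReal_union_add_inter (μ := stdSpace) (s := fstEvent f p) hB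
  rw [measureReal_fstEvent hf hp] at hdiff hunion
  rw [Set.inter_comm, measureReal_fstEvent hf hq] at hdiff'
  rw [measureReal_fstEvent hf hq] at hunion
  rw [probReal_univ] at hcompl
  have hsymm := measureReal_union_le (μ := stdSpace) (fstEvent f p \ fstEvent f q)
    (fstEvent f q \ fstEvent f p)
  rw [Set.symmDiff_def, div_mul_eq_mul_div, le_div_iff₀ (by linarith)]
  refine (mul_le_mul_of_nonneg_right hsymm (by linarith)).trans ?_
  rw [hcompl, eq_sub_of_add_eq hunion, eq_sub_of_add_eq' hdiff, eq_sub_of_add_eq' hdiff'] at hcost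
  rw [eq_sub_of_add_eq' hdiff, eq_sub_of_add_eq' hdiff']
  linarith

lemma not_linked_swap (h : optRatio (fun x y : X => dist x y)
    (fun P : ProbabilityMeasure X => (P : Measure X)) = 1) {x y : X} (hxy : x ≠ y) :
    ¬ Linked (x, y) (y, x) := by
  rintro ⟨K, hK⟩
  have hpos : 0 < 1 / (|K| + 1) / 2 := by positivity
  obtain ⟨f, hf⟩ := exists_isNearOptimal h hpos
  have hle := hK _ hpos f hf
  have hswap : pairProb (y, x) = pairProb (x, y) := Subtype.ext (pairMeasure_swap (x, y))
  have hcover : Set.univ ≤ᵐ[stdSpace] symmDiff (fstEvent f (x, y)) (fstEvent f (y, x)) := by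
    filter_upwards [ae_eq_snd hf (x, y)] with u hu _
    have hy : u ∈ fstEvent f (y, x) ↔ f (pairProb (x, y)) u = y := by
      rw [fstEvent, hswap]; rfl
    by_cases hx : u ∈ fstEvent f (x, y)
    · refine .inl ⟨hx, fun h' => hxy ?_⟩
      rw [← hy.1 h']
      exact (show f (pairProb (x, y)) u = x from hx).symm
    · exact .inr ⟨hy.2 (hu hx), hx⟩
  have hone : (1 : ℝ) ≤ stdSpace.real (symmDiff (fstEvent f (x, y)) (fstEvent f (y, x))) := by
    rw [← probReal_univ (μ := stdSpace)]
    exact ENNReal.toReal_mono (measure_ne_top _ _) (measure_mono_ae hcover)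
  have hK1 : K * (1 / (|K| + 1) / 2) ≤ 1 / 2 := by
    rw [show K * (1 / (|K| + 1) / 2) = K / (|K| + 1) / 2 by ring]
    have : K / (|K| + 1) ≤ 1 := (div_le_one (by positivity)).2 (by linarith [le_abs_self K])
    linarith
  linarith

variable [TopologicalSpace.SeparableSpace X]

lemma exists_between_of_optRatio_eq_one (h : optRatio (fun x y : X => dist x y)
    (fun P : ProbabilityMeasure X => (P : Measure X)) = 1) (x y z : X) :
    dist x z = dist x y + dist y z ∨ dist x y = dist x z + dist y z ∨
      dist y z = dist x y + dist x z := by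
  by_contra! H
  obtain ⟨h1, h2, h3⟩ := H
  have hxy : x ≠ y := by rintro rfl; simp at h1
  have hyz : y ≠ z := by rintro rfl; simp at h1
  have hxz : x ≠ z := by rintro rfl; simp at h2; exact h2 (dist_comm _ _)
  have t1 := lt_of_le_of_ne (dist_triangle x y z) h1
  have t2 := lt_of_le_of_ne (dist_triangle_right x y z) h2
  have t3 := lt_of_le_of_ne (dist_triangle_left y z x) h3
  refine not_linked_swap h hxy (((linked_of_lt (q := (z, y)) hxy hyz.symm ?_).trans
    (linked_of_lt (q := (z, x)) hyz.symm hxz.symm ?_)).trans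
    (linked_of_lt hxz.symm hxy.symm ?_)) <;>
  · simp only [dist_self, dist_comm z, dist_comm y x]
    linarith

/-- There is no pseudo-linear quadruple, i.e. no `4`-cycle with opposite sides equal and with
diagonals of length half the perimeter. -/
lemma not_pseudolinear_of_optRatio_eq_one (h : optRatio (fun x y : X => dist x y)
    (fun P : ProbabilityMeasure X => (P : Measure X)) = 1) {a b c d : X} {s t : ℝ}
    (hs : 0 < s) (ht : 0 < t) (hab : dist a b = s) (hcd : dist c d = s) (hbc : dist b c = t)
    (had : dist a d = t) (hac : dist a c = s + t) (hbd : dist b d = s + t) : False := by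
  have nab : a ≠ b := dist_pos.1 (by linarith)
  have nac : a ≠ c := dist_pos.1 (by linarith)
  have nbc : b ≠ c := dist_pos.1 (by linarith)
  have nbd : b ≠ d := dist_pos.1 (by linarith)
  have ncd : c ≠ d := dist_pos.1 (by linarith)
  refine not_linked_swap h nab (((((linked_of_lt (q := (a, c)) nab nac ?_).trans
    (linked_of_lt (q := (b, c)) nac nbc ?_)).trans (linked_of_lt (q := (b, d)) nbc nbd ?_)).trans
    (linked_of_lt (q := (c, d)) nbd ncd ?_)).trans (linked_of_lt ncd nab.symm ?_)) <;>
  · simp only [dist_self, dist_comm c b, dist_comm d, dist_comm b a, dist_comm c a]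
    linarith

end TwoPoint

/-- The criterion of Menger for embedding a metric space in the line. -/
lemma exists_abs_sub_of_triples_of_quadruples {X : Type*} [MetricSpace X] [Nontrivial X]
    (hT : ∀ x y z : X, dist x z = dist x y + dist y z ∨ dist x y = dist x z + dist y z ∨
      dist y z = dist x y + dist x z)
    (hQ : ∀ (a b c d : X) (s t : ℝ), 0 < s → 0 < t → dist a b = s → dist c d = s →
      dist b c = t → dist a d = t → dist a c = s + t → dist b d = s + t → False) :
    ∃ g : X → ℝ, ∀ x y : X, dist x y = |g x - g y| := by
  obtain ⟨o, e, hoe⟩ := exists_pair_ne X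
  obtain ⟨L, hL⟩ : ∃ L, L = dist o e := ⟨_, rfl⟩
  have hLpos : 0 < L := hL ▸ dist_pos.2 hoe
  have hg : ∀ z, ∃ r : ℝ, dist o z = |r| ∧ dist e z = |r - L| := by
    intro z
    have hnn : 0 ≤ dist o z := dist_nonneg
    have hnn' : 0 ≤ dist e z := dist_nonneg
    rcases hT o e z with h | h | h
    · refine ⟨dist o z, (abs_of_nonneg hnn).symm, ?_⟩
      rw [abs_of_nonneg] <;> linarith
    · refine ⟨dist o z, (abs_of_nonneg hnn).symm, ?_⟩
      rw [abs_of_nonpos] <;> linarith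
    · refine ⟨-dist o z, by rw [abs_neg, abs_of_nonneg hnn], ?_⟩
      rw [abs_of_nonpos] <;> linarith
  choose g hgo hge using hg
  refine ⟨g, fun z w => ?_⟩
  have hdich : ∀ (p : X) (a b : ℝ), dist p z = |a| → dist p w = |b| →
      dist z w = |a - b| ∨ dist z w = |a + b| := by
    intro p a b ha hb
    have hT' := hT p z w
    rw [ha, hb] at hT'
    have hnn : 0 ≤ dist z w := dist_nonneg
    rcases abs_cases a with ⟨h1, h1'⟩ | ⟨h1, h1'⟩ <;>
    rcases abs_cases b with ⟨h2, h2'⟩ | ⟨h2, h2'⟩ <;>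
    rcases abs_cases (a - b) with ⟨h3, h3'⟩ | ⟨h3, h3'⟩ <;>
    rcases abs_cases (a + b) with ⟨h4, h4'⟩ | ⟨h4, h4'⟩ <;>
    rw [h1, h2] at hT' <;> rw [h3, h4] <;>
    rcases hT' with h | h | h <;>
    first
    | (left; linarith)
    | (right; linarith)
  rcases hdich o _ _ (hgo z) (hgo w) with h | h1
  · exact h
  rcases hdich e _ _ (hge z) (hge w) with h | h2
  · rw [h]; congr 1; ring
  have hsum : g z + g w = L := by
    rw [h1] at h2
    rcases abs_eq_abs.1 h2 with h | h <;> linarith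
  have hzw : dist z w = L := by rw [h1, hsum, abs_of_pos hLpos]
  have hw : g w = L - g z := by linarith
  have how := hgo w
  have hew := hge w
  have hoz := hgo z
  have hez := hge z
  rw [hw] at how hew
  rw [abs_sub_comm] at hez
  rw [show L - g z - L = -g z by ring, abs_neg] at hew
  rw [hzw, hw]
  rcases lt_trichotomy (g z) 0 with hz | hz | hz
  · rw [abs_of_neg hz] at hoz hew
    rw [abs_of_pos (by linarith)] at hez how
    exact (hQ z o e w (-g z) L (by linarith) hLpos (by rw [dist_comm, hoz]) hew hL.symm hzw
      (by rw [dist_comm, hez]; ring) (by rw [how]; ring)).elim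
  · rw [hz]; simp [abs_of_pos hLpos]
  rcases lt_trichotomy (g z) L with hz' | hz' | hz'
  · rw [abs_of_pos hz] at hoz hew
    rw [abs_of_pos (by linarith)] at hez how
    exact (hQ o z e w (g z) (L - g z) hz (by linarith) hoz hew (by rw [dist_comm, hez]) how
      (by rw [← hL]; ring) (by rw [hzw]; ring)).elim
  · rw [hz']; simp [abs_of_pos hLpos]
  · rw [abs_of_pos hz] at hoz hew
    rw [abs_of_neg (by linarith)] at hez how
    exact (hQ w o e z (g z - L) L (by linarith) hLpos (by rw [dist_comm, how]; ring)
      (by rw [hez]; ring) hL.symm (by rw [dist_comm, hzw])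
      (by rw [dist_comm, hew]; ring) (by rw [hoz]; ring)).elim

/-- for a complete separable metric space `(X, c)` with at least two
points, the optimal pairwise coupling ratio of the family of all Borel probability
measures on `X` (with cost the metric `c`) equals `1` if and only if `(X, c)` embeds
isometrically into `ℝ` with the metric `(x,y) ↦ |x - y|`. -/
theorem optRatio_eq_one_iff_isometric_embedding_real {X : Type*} [MetricSpace X]
    [CompleteSpace X] [TopologicalSpace.SeparableSpace X] [Nontrivial X]
    [MeasurableSpace X] [BorelSpace X] :
    optRatio (fun x y : X => dist x y)
        (fun P : ProbabilityMeasure X => (P : Measure X)) = 1 ↔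
      ∃ g : X → ℝ, ∀ x y : X, dist x y = |g x - g y| := by
  refine ⟨fun h => exists_abs_sub_of_triples_of_quadruples
    (exists_between_of_optRatio_eq_one h)
    (fun a b c d s t => not_pseudolinear_of_optRatio_eq_one h), ?_⟩
  rintro ⟨g, hg⟩
  exact le_antisymm
    (optRatio_le_one_of_isometry (Isometry.of_dist_eq fun x y => (hg x y).symm))
    (one_le_optRatio _ _)

end
end

section
/- Let n ≥ 1, 0 < q < 1, and define the snowflake metric d(x,y) := ‖x − y‖_2^q on ℝⁿ. Let P_d(ℝⁿ) be the set of Borel probability measures P on ℝⁿ with ∫∫ ‖x − y‖_2^q P(dx) P(dy) < ∞, metrized by the earth mover's distance C*_d. Let L₁ be the Banach space of (equivalence classes of) Lebesgue integrable functions f : [0,1] → ℝ with norm ‖f‖₁ = ∫₀¹ |f(t)| dt. Then there exists a map ζ : P_d(ℝⁿ) → L₁ and a real number r ≤ 10.55·n^{q/2}/(1 − q) such that C*_d(P,Q) ≤ ‖ζ(P) − ζ(Q)‖₁ ≤ r·C*_d(P,Q) for all P, Q ∈ P_d(ℝⁿ); that is, (P_d(ℝⁿ), C*_d) admits a bi-Lipschitz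 embedding into L₁ with distortion at most 10.55·n^{q/2}/(1 − q). -/
open MeasureTheory ENNReal

noncomputable section

/-- The snowflake cost `d(x,y) = ‖x − y‖₂^q` on `ℝⁿ`. -/
def snowflake (n : ℕ) (q : ℝ) (x y : EuclideanSpace ℝ (Fin n)) : ℝ := ‖x - y‖ ^ q

/-- The space `L₁ = L₁([0,1])` of integrable functions on `[0,1]` (with Lebesgue
measure), with norm `‖f‖₁ = ∫₀¹ |f|`. -/
abbrev LOne : Type := Lp ℝ 1 (volume.restrict (Set.Icc (0 : ℝ) 1))

open ProbabilityTheory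

section Transshipment

variable {X : Type*} [MeasurableSpace X]

/-- Move the second coordinate by the kernel `κ`, surviving with probability `u`. -/
def killedStep (u : X → ℝ≥0∞) (κ : Kernel X X) (π : Measure (X × X)) : Measure (X × X) :=
  (π.withDensity fun p => u p.2).bind
    (Kernel.deterministic Prod.fst measurable_fst ×ₖ κ.comap Prod.snd measurable_snd)

lemma lintegral_killedStep {u : X → ℝ≥0∞} (hu : Measurable u) (κ : Kernel X X) [IsMarkovKernel κ]
    (π : Measure (X × X)) {f : X × X → ℝ≥0∞} (hf : Measurable f) :
    ∫⁻ p, f p ∂(killedStep u κ π) = ∫⁻ p, u p.2 * ∫⁻ z, f (p.1, z) ∂(κ p.2) ∂π := by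
  have hm : Measurable fun p : X × X => ∫⁻ z, f (p.1, z) ∂(κ p.2) := by
    have := Measurable.lintegral_kernel_prod_right (κ := κ.comap Prod.snd measurable_snd)
      (f := fun (p : X × X) (z : X) => f (p.1, z)) (by fun_prop)
    simpa using this
  rw [killedStep, Measure.lintegral_bind (Kernel.aemeasurable _) hf.aemeasurable]
  simp_rw [Kernel.lintegral_deterministic_prod measurable_fst _ _ hf, Kernel.comap_apply]
  rw [lintegral_withDensity_eq_lintegral_mul _ (by fun_prop) hm]
  rfl

/-- Joint law of the starting point (of law `P`) and of the position after `n` killed steps. -/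
def killedChain (u : X → ℝ≥0∞) (κ : Kernel X X) (P : Measure X) : ℕ → Measure (X × X)
  | 0 => P.map fun x => (x, x)
  | n + 1 => killedStep u κ (killedChain u κ P n)

lemma lintegral_killedChain_zero (u : X → ℝ≥0∞) (κ : Kernel X X) (P : Measure X)
    {f : X × X → ℝ≥0∞} (hf : Measurable f) :
    ∫⁻ p, f p ∂(killedChain u κ P 0) = ∫⁻ x, f (x, x) ∂P := by
  rw [killedChain, lintegral_map hf (by fun_prop)]

lemma lintegral_killedChain_succ {u : X → ℝ≥0∞} (hu : Measurable u) (κ : Kernel X X)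
    [IsMarkovKernel κ] (P : Measure X) (n : ℕ) {f : X × X → ℝ≥0∞} (hf : Measurable f) :
    ∫⁻ p, f p ∂(killedChain u κ P (n + 1)) =
      ∫⁻ p, u p.2 * ∫⁻ z, f (p.1, z) ∂(κ p.2) ∂(killedChain u κ P n) := by
  rw [killedChain, lintegral_killedStep hu κ _ hf]

lemma sum_lintegral_killedChain_le {u : X → ℝ≥0∞} (hu : Measurable u) (κ : Kernel X X)
    [IsMarkovKernel κ] (P Λ : Measure X)
    (h : ∀ f : X → ℝ≥0∞, Measurable f →
      ∫⁻ x, f x ∂P + ∫⁻ y, u y * ∫⁻ z, f z ∂(κ y) ∂Λ ≤ ∫⁻ y, f y ∂Λ)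
    (N : ℕ) {f : X → ℝ≥0∞} (hf : Measurable f) :
    ∑ n ∈ Finset.range N, ∫⁻ p, f p.2 ∂(killedChain u κ P n) ≤ ∫⁻ y, f y ∂Λ := by
  induction N generalizing f with
  | zero => simp
  | succ N ih =>
    rw [Finset.sum_range_succ', lintegral_killedChain_zero _ _ _ (by fun_prop), add_comm]
    refine le_trans ?_ (h f hf)
    gcongr
    simp_rw [lintegral_killedChain_succ hu κ P _ (f := fun p => f p.2) (by fun_prop)]
    have hm : Measurable fun y => ∫⁻ z, f z ∂(κ y) := by fun_prop
    exact ih (f := fun y => u y * ∫⁻ z, f z ∂(κ y)) (by fun_prop)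

lemma tsum_lintegral_killedChain_le {u : X → ℝ≥0∞} (hu : Measurable u) (κ : Kernel X X)
    [IsMarkovKernel κ] (P Λ : Measure X)
    (h : ∀ f : X → ℝ≥0∞, Measurable f →
      ∫⁻ x, f x ∂P + ∫⁻ y, u y * ∫⁻ z, f z ∂(κ y) ∂Λ ≤ ∫⁻ y, f y ∂Λ)
    {f : X → ℝ≥0∞} (hf : Measurable f) :
    ∑' n, ∫⁻ p, f p.2 ∂(killedChain u κ P n) ≤ ∫⁻ y, f y ∂Λ :=
  ENNReal.tsum_le_of_sum_range_le fun N => sum_lintegral_killedChain_le hu κ P Λ h N hf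

lemma sum_add_lintegral_killedChain {u s : X → ℝ≥0∞} (hu : Measurable u) (hs : Measurable s)
    (hus : ∀ x, s x + u x = 1) (κ : Kernel X X) [IsMarkovKernel κ] (P : Measure X)
    {f : X → ℝ≥0∞} (hf : Measurable f) (N : ℕ) :
    ∑ n ∈ Finset.range N, ∫⁻ p, s p.2 * f p.1 ∂(killedChain u κ P n) +
      ∫⁻ p, f p.1 ∂(killedChain u κ P N) = ∫⁻ x, f x ∂P := by
  induction N with
  | zero => simp [lintegral_killedChain_zero u κ P (f := fun p => f p.1) (by fun_prop)]
  | succ N ih =>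
    rw [Finset.sum_range_succ, ← ih, add_assoc]
    congr 1
    rw [lintegral_killedChain_succ hu κ P _ (f := fun p => f p.1) (by fun_prop),
      ← lintegral_add_left (by fun_prop)]
    simp [← add_mul, hus]

lemma sum_add_lintegral_cost_killedChain_le {u s : X → ℝ≥0∞} (hu : Measurable u)
    (hs : Measurable s) (hus : ∀ x, s x + u x = 1) (κ : Kernel X X) [IsMarkovKernel κ]
    (P : Measure X) {c : X × X → ℝ≥0∞} (hc : Measurable c) (hc0 : ∀ x, c (x, x) = 0)
    (hct : ∀ x y z, c (x, z) ≤ c (x, y) + c (y, z)) (N : ℕ) :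
    ∑ n ∈ Finset.range N, ∫⁻ p, s p.2 * c p ∂(killedChain u κ P n) +
      ∫⁻ p, c p ∂(killedChain u κ P N) ≤
    ∑ n ∈ Finset.range N, ∫⁻ p, u p.2 * ∫⁻ z, c (p.2, z) ∂(κ p.2) ∂(killedChain u κ P n) := by
  have hm : Measurable fun y => ∫⁻ z, c (y, z) ∂(κ y) :=
    Measurable.lintegral_kernel_prod_right (κ := κ) (f := fun y z => c (y, z)) (by fun_prop)
  induction N with
  | zero => simp [lintegral_killedChain_zero u κ P hc, hc0]
  | succ N ih =>
    rw [Finset.sum_range_succ, Finset.sum_range_succ]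
    refine le_trans ?_ (add_le_add_left ih _)
    rw [add_assoc, add_assoc]
    refine add_le_add le_rfl ?_
    rw [lintegral_killedChain_succ hu κ P _ hc, ← lintegral_add_left (by fun_prop),
      ← lintegral_add_left (by fun_prop)]
    refine lintegral_mono fun p => ?_
    have h1 : ∫⁻ z, c (p.1, z) ∂(κ p.2) ≤ c p + ∫⁻ z, c (p.2, z) ∂(κ p.2) := by
      calc ∫⁻ z, c (p.1, z) ∂(κ p.2) ≤ ∫⁻ z, (c (p.1, p.2) + c (p.2, z)) ∂(κ p.2) :=
            lintegral_mono fun z => hct _ _ _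
        _ = _ := by rw [lintegral_add_left (by fun_prop)]; simp
    calc s p.2 * c p + u p.2 * ∫⁻ z, c (p.1, z) ∂(κ p.2)
        ≤ s p.2 * c p + u p.2 * (c p + ∫⁻ z, c (p.2, z) ∂(κ p.2)) := by gcongr
      _ = (s p.2 + u p.2) * c p + u p.2 * ∫⁻ z, c (p.2, z) ∂(κ p.2) := by ring
      _ = _ := by rw [hus, one_mul]

/-- A stationary splitting of `α + Q` into a stopped part and a moved part. -/
lemma exists_stopping_split (α Q : Measure X) [IsFiniteMeasure α] [IsFiniteMeasure Q] :
    ∃ s u : X → ℝ≥0∞, Measurable s ∧ Measurable u ∧ (∀ x, s x + u x = 1) ∧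
      (α + Q).withDensity s = Q ∧ (α + Q).withDensity u = α := by
  set Λ := α + Q
  have hQ : Q ≤ Λ := Measure.le_add_left le_rfl
  let s : X → ℝ≥0∞ := fun x => min (Q.rnDeriv Λ x) 1
  have hs : Measurable s := by fun_prop
  have hsu : ∀ x, s x + (1 - s x) = 1 := fun x => add_tsub_cancel_of_le (min_le_right _ _)
  have hsQ : Λ.withDensity s = Q := by
    rw [← Measure.withDensity_rnDeriv_eq Q Λ (Measure.absolutelyContinuous_of_le hQ)]
    refine withDensity_congr_ae ?_
    filter_upwards [Measure.rnDeriv_le_one_of_le hQ] with x hx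
    exact min_eq_left hx
  refine ⟨s, fun x => 1 - s x, hs, by fun_prop, hsu, hsQ, ?_⟩
  have h1 : Λ.withDensity s + Λ.withDensity (fun x => 1 - s x) = Λ := by
    rw [← withDensity_add_left hs]
    have : s + (fun x => 1 - s x) = 1 := funext hsu
    rw [this, withDensity_one]
  rw [hsQ] at h1
  have h2 : Q + Λ.withDensity (fun x => 1 - s x) = Q + α := by rw [h1, add_comm]
  exact le_antisymm (Measure.le_of_add_le_add_left h2.le) (Measure.le_of_add_le_add_left h2.ge)

/-- Transshipment bounds transport: a finite flow `γ` whose divergence is `P - Q` can be turned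
into a coupling of `P` and `Q` which is no more costly. -/
theorem exists_coupling_of_flow [StandardBorelSpace X] [Nonempty X]
    {c : X × X → ℝ≥0∞} (hc : Measurable c)
    (hc0 : ∀ x, c (x, x) = 0) (hct : ∀ x y z, c (x, z) ≤ c (x, y) + c (y, z))
    (P Q : Measure X) [IsProbabilityMeasure P] [IsProbabilityMeasure Q]
    (γ : Measure (X × X)) [IsFiniteMeasure γ] (h : γ.fst + Q = γ.snd + P) :
    ∃ ρ : Measure (X × X), IsProbabilityMeasure ρ ∧ ρ.map Prod.fst = P ∧ ρ.map Prod.snd = Q ∧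
      ∫⁻ z, c z ∂ρ ≤ ∫⁻ z, c z ∂γ := by
  obtain ⟨s, u, hs, hu, hus, hsQ, huα⟩ := exists_stopping_split γ.fst Q
  set Λ := γ.fst + Q with hΛ
  set κ := γ.condKernel
  have hγ : γ.fst ⊗ₘ κ = γ := Measure.disintegrate γ _
  have hmove : ∀ f : X × X → ℝ≥0∞, Measurable f →
      ∫⁻ y, u y * ∫⁻ z, f (y, z) ∂(κ y) ∂Λ = ∫⁻ p, f p ∂γ := by
    intro f hf
    have hm : Measurable fun y => ∫⁻ z, f (y, z) ∂(κ y) :=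
      Measurable.lintegral_kernel_prod_right (κ := κ) (f := fun y z => f (y, z)) (by fun_prop)
    conv_rhs => rw [← hγ, Measure.lintegral_compProd hf, ← huα,
      lintegral_withDensity_eq_lintegral_mul _ hu hm]
    rfl
  have hocc : ∀ f : X → ℝ≥0∞, Measurable f →
      ∫⁻ x, f x ∂P + ∫⁻ y, u y * ∫⁻ z, f z ∂(κ y) ∂Λ ≤ ∫⁻ y, f y ∂Λ := by
    intro f hf
    rw [hmove (fun p => f p.2) (by fun_prop), h, lintegral_add_measure, Measure.snd,
      lintegral_map hf (by fun_prop), add_comm]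
  let π := killedChain u κ P
  let ρ : Measure (X × X) := Measure.sum fun n => (π n).withDensity fun p => s p.2
  have hρ : ∀ f : X × X → ℝ≥0∞, Measurable f →
      ∫⁻ p, f p ∂ρ = ∑' n, ∫⁻ p, s p.2 * f p ∂(π n) := by
    intro f hf
    rw [lintegral_sum_measure]
    congr with n
    rw [lintegral_withDensity_eq_lintegral_mul _ (by fun_prop) hf]
    rfl
  have hmass : Filter.Tendsto (fun n => π n Set.univ) Filter.atTop (nhds 0) := by
    apply ENNReal.tendsto_atTop_zero_of_tsum_ne_top
    have := tsum_lintegral_killedChain_le hu κ P Λ hocc (f := fun _ => 1) measurable_const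
    simp only [lintegral_one] at this
    exact ne_top_of_le_ne_top (measure_ne_top Λ _) this
  have hfst : ρ.map Prod.fst = P := by
    ext A hA
    rw [← lintegral_indicator_one hA, ← lintegral_indicator_one hA,
      lintegral_map (measurable_one.indicator hA) measurable_fst,
      hρ (fun p => A.indicator 1 p.1) ((measurable_one.indicator hA).comp measurable_fst)]
    have hf : Measurable (A.indicator (1 : X → ℝ≥0∞)) := measurable_one.indicator hA
    have key := sum_add_lintegral_killedChain hu hs hus κ P hf
    have hz : Filter.Tendsto (fun n => ∫⁻ p, A.indicator (1 : X → ℝ≥0∞) p.1 ∂(π n))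
        Filter.atTop (nhds 0) := by
      refine tendsto_of_tendsto_of_tendsto_of_le_of_le tendsto_const_nhds hmass
        (fun _ => zero_le) fun n => ?_
      rw [← lintegral_one]
      exact lintegral_mono fun p => Set.indicator_le_self' (fun _ _ => zero_le) p.1
    have h1 := (ENNReal.tendsto_nat_tsum
      (fun n => ∫⁻ p, s p.2 * A.indicator (1 : X → ℝ≥0∞) p.1 ∂(π n))).add hz
    rw [add_zero] at h1
    refine tendsto_nhds_unique h1 ?_
    simp only [π, key]
    exact tendsto_const_nhds
  have huniv : ρ Set.univ = 1 := by
    rw [← Set.preimage_univ (f := Prod.fst), ← Measure.map_apply measurable_fst .univ, hfst,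
      measure_univ]
  have hprob : IsProbabilityMeasure ρ := ⟨huniv⟩
  have hsnd_le : ρ.map Prod.snd ≤ Q := by
    refine Measure.le_iff.2 fun A hA => ?_
    rw [← lintegral_indicator_one hA, ← lintegral_indicator_one hA]
    have hf : Measurable (A.indicator (1 : X → ℝ≥0∞)) := measurable_one.indicator hA
    rw [lintegral_map hf measurable_snd, hρ (fun p => A.indicator 1 p.2) (hf.comp measurable_snd)]
    refine (tsum_lintegral_killedChain_le hu κ P Λ hocc
      (f := fun y => s y * A.indicator 1 y) (by fun_prop)).trans ?_
    conv_rhs => rw [← hsQ, lintegral_withDensity_eq_lintegral_mul _ hs hf]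
    rfl
  have : IsProbabilityMeasure (ρ.map Prod.snd) :=
    Measure.isProbabilityMeasure_map measurable_snd.aemeasurable
  refine ⟨ρ, hprob, hfst, Measure.eq_of_le_of_isProbabilityMeasure hsnd_le, ?_⟩
  have hm : Measurable fun y => ∫⁻ z, c (y, z) ∂(κ y) :=
    Measurable.lintegral_kernel_prod_right (κ := κ) (f := fun y z => c (y, z)) (by fun_prop)
  rw [hρ c hc, ← hmove c hc]
  refine ENNReal.tsum_le_of_sum_range_le fun N => ?_
  refine le_trans (le_self_add.trans
    (sum_add_lintegral_cost_killedChain_le hu hs hus κ P hc hc0 hct N)) ?_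
  exact sum_lintegral_killedChain_le hu κ P Λ hocc N
    (f := fun y => u y * ∫⁻ z, c (y, z) ∂(κ y)) (by fun_prop)

end Transshipment


section Isometry

lemma exists_map_restrict_Icc_eq {Y : Type*} [MeasurableSpace Y] [StandardBorelSpace Y]
    [Nonempty Y] (ρ : Measure Y) [IsProbabilityMeasure ρ] :
    ∃ T : ℝ → Y, MeasurePreserving T (volume.restrict (Set.Icc (0 : ℝ) 1)) ρ := by
  obtain ⟨f, hf, hfρ⟩ := ρ.exists_measurable_map_eq
  have hp : Measurable (Set.projIcc (0 : ℝ) 1 zero_le_one) := continuous_projIcc.measurable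
  refine ⟨f ∘ Set.projIcc 0 1 zero_le_one, hf.comp hp, ?_⟩
  rw [← Measure.map_map hf hp, ← hfρ]
  congr 1
  have h1 : (volume.restrict (Set.Icc (0 : ℝ) 1)) =
      (volume : Measure unitInterval).map Subtype.val :=
    (map_comap_subtype_coe measurableSet_Icc volume).symm
  rw [h1, Measure.map_map hp measurable_subtype_coe]
  have h2 : Set.projIcc (0 : ℝ) 1 zero_le_one ∘ Subtype.val = id := by
    ext x; simp
  rw [h2, Measure.map_id]

/-- `L¹` of a σ-finite measure on a standard Borel space embeds isometrically in `L¹([0,1])`. -/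
theorem exists_isometry_LOne {Y : Type*} [MeasurableSpace Y] [StandardBorelSpace Y] [Nonempty Y]
    (μ : Measure Y) [SigmaFinite μ] [NeZero μ] :
    ∃ Φ : (Y → ℝ) → LOne, ∀ f g : Y → ℝ, Measurable f → Measurable g →
      ∫⁻ y, ‖f y‖ₑ ∂μ < ⊤ → ∫⁻ y, ‖g y‖ₑ ∂μ < ⊤ →
      ENNReal.ofReal ‖Φ f - Φ g‖ = ∫⁻ y, ‖f y - g y‖ₑ ∂μ := by
  classical
  let ρ := μ.toFinite
  obtain ⟨T, hT⟩ := exists_map_restrict_Icc_eq ρ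
  let h : Y → ℝ := fun y => (μ.rnDeriv ρ y).toReal
  have hh : Measurable h := by fun_prop
  have key : ∀ f : Y → ℝ, Measurable f →
      ∫⁻ t in Set.Icc (0 : ℝ) 1, ‖f (T t) * h (T t)‖ₑ = ∫⁻ y, ‖f y‖ₑ ∂μ := by
    intro f hf
    rw [hT.lintegral_comp (f := fun y => ‖f y * h y‖ₑ) (by fun_prop)]
    conv_rhs => rw [← Measure.withDensity_rnDeriv_eq μ ρ (absolutelyContinuous_toFinite μ),
      lintegral_withDensity_eq_lintegral_mul _ (by fun_prop) (by fun_prop)]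
    refine lintegral_congr_ae ?_
    filter_upwards [Measure.rnDeriv_lt_top μ ρ] with y hy
    simp only [enorm_mul, Pi.mul_apply, h]
    rw [mul_comm, Real.enorm_of_nonneg ENNReal.toReal_nonneg, ENNReal.ofReal_toReal hy.ne]
  have h_int : ∀ f : Y → ℝ, Measurable f → ∫⁻ y, ‖f y‖ₑ ∂μ < ⊤ →
      Integrable (fun t => f (T t) * h (T t)) (volume.restrict (Set.Icc (0 : ℝ) 1)) := by
    intro f hf hfin
    have hT' := hT.measurable
    refine ⟨Measurable.aestronglyMeasurable (by fun_prop), ?_⟩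
    rw [HasFiniteIntegral, key f hf]
    exact hfin
  refine ⟨fun f => if hf : Integrable (fun t => f (T t) * h (T t))
    (volume.restrict (Set.Icc (0 : ℝ) 1)) then hf.toL1 _ else 0, fun f g hf hg hfi hgi => ?_⟩
  simp only [dif_pos (h_int f hf hfi), dif_pos (h_int g hg hgi)]
  rw [← Integrable.toL1_sub, Integrable.norm_toL1]
  simp_rw [edist_zero_right]
  rw [ENNReal.ofReal_toReal ((h_int f hf hfi).sub (h_int g hg hgi)).2.ne]
  rw [← key (fun y => f y - g y) (by fun_prop)]
  refine lintegral_congr fun t => ?_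
  simp [sub_mul]

end Isometry


section GaussianPDF

variable (E : Type*) [NormedAddCommGroup E] [InnerProductSpace ℝ E]

/-- The density of `isoGaussian E σ`. -/
def isoGaussianPDF (σ : ℝ) (z : E) : ℝ :=
  ((2 * Real.pi * σ ^ 2) ^ (Module.finrank ℝ E / 2 : ℝ))⁻¹ * Real.exp (-(2 * σ ^ 2)⁻¹ * ‖z‖ ^ 2)

variable {E}

@[fun_prop]
lemma continuous_isoGaussianPDF (σ : ℝ) : Continuous (isoGaussianPDF E σ) := by
  unfold isoGaussianPDF; fun_prop

lemma isoGaussianPDF_nonneg (σ : ℝ) (z : E) : 0 ≤ isoGaussianPDF E σ z := by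
  unfold isoGaussianPDF; positivity

lemma isoGaussianPDF_le (σ : ℝ) (z : E) :
    isoGaussianPDF E σ z ≤ ((2 * Real.pi * σ ^ 2) ^ (Module.finrank ℝ E / 2 : ℝ))⁻¹ := by
  unfold isoGaussianPDF
  refine mul_le_of_le_one_right (by positivity) (Real.exp_le_one_iff.2 ?_)
  rw [neg_mul]
  exact neg_nonpos.2 (by positivity)

@[fun_prop]
lemma measurable_isoGaussianPDF [MeasurableSpace E] [OpensMeasurableSpace E] (σ : ℝ) :
    Measurable (isoGaussianPDF E σ) :=
  (continuous_isoGaussianPDF σ).measurable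

lemma isoGaussianPDF_mul (σ : ℝ) (x y z : E) :
    isoGaussianPDF E σ (z - x) * isoGaussianPDF E σ (z - y) =
      (isoGaussianPDF E σ (z - (2⁻¹ : ℝ) • (x + y)) *
        Real.exp (-(‖x - y‖ ^ 2 / (8 * σ ^ 2)))) ^ 2 := by
  have hp := parallelogram_law_with_norm ℝ (z - x) (z - y)
  have e1 : z - x + (z - y) = (2 : ℝ) • (z - (2⁻¹ : ℝ) • (x + y)) := by
    rw [smul_sub, smul_smul, two_smul]; norm_num; abel
  have e2 : z - x - (z - y) = -(x - y) := by abel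
  rw [e1, e2, norm_neg, norm_smul] at hp
  norm_num at hp
  have hp' : ‖z - x‖ ^ 2 + ‖z - y‖ ^ 2 =
      2 * ‖z - (2⁻¹ : ℝ) • (x + y)‖ ^ 2 + ‖x - y‖ ^ 2 / 2 := by
    norm_num
    linarith
  unfold isoGaussianPDF
  rw [mul_mul_mul_comm, ← Real.exp_add, mul_assoc _ (Real.exp _) (Real.exp _), ← Real.exp_add,
    mul_pow, ← pow_two, ← Real.exp_nat_mul, ← mul_add, hp']
  congr 2
  rw [mul_inv]
  push_cast
  field_simp
  ring

/-- The density of `P ∗ isoGaussian E σ`. -/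
def smoothed [MeasurableSpace E] (σ : ℝ) (P : Measure E) (z : E) : ℝ≥0∞ :=
  ∫⁻ x, ENNReal.ofReal (isoGaussianPDF E σ (z - x)) ∂P

lemma smoothed_lt_top [MeasurableSpace E] (σ : ℝ) (P : Measure E) [IsFiniteMeasure P] (z : E) :
    smoothed σ P z < ⊤ := by
  refine (lintegral_mono fun x => ENNReal.ofReal_le_ofReal (isoGaussianPDF_le σ (z - x))).trans_lt ?_
  rw [lintegral_const]
  exact ENNReal.mul_lt_top ENNReal.ofReal_lt_top (measure_lt_top _ _)

end GaussianPDF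

lemma abs_sub_le_of_mul_eq_sq {a b m D : ℝ} (ha : 0 ≤ a) (hb : 0 ≤ b) (hm : 0 ≤ m) (hD : 0 < D)
    (h : a * b = m ^ 2) : |a - b| ≤ 2 / D * (a + b - 2 * m) + D / 8 * (a + b + 2 * m) := by
  have hm' : 2 * m ≤ a + b :=
    abs_le_of_sq_le_sq' (by nlinarith [sq_nonneg (a - b)]) (by positivity) |>.2
  set u := a + b - 2 * m
  set v := a + b + 2 * m
  have huv : (a - b) ^ 2 = u * v := by simp only [u, v]; nlinarith
  have hu : 0 ≤ u := by simp only [u]; linarith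
  have hv : 0 ≤ v := by simp only [v]; linarith
  apply abs_le_of_sq_le_sq _ (by positivity)
  rw [huv]
  have h1 : u * v = 4 * (2 / D * u) * (D / 8 * v) := by field_simp; ring
  nlinarith [sq_nonneg (2 / D * u - D / 8 * v)]

lemma ofReal_sub_add_ofReal_sub (a b : ℝ) (ha : 0 ≤ a) (hb : 0 ≤ b) :
    ENNReal.ofReal a - ENNReal.ofReal b + (ENNReal.ofReal b - ENNReal.ofReal a) =
      ENNReal.ofReal |a - b| := by
  rw [← ENNReal.ofReal_sub _ hb, ← ENNReal.ofReal_sub _ ha]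
  rcases le_total a b with h | h
  · rw [ENNReal.ofReal_of_nonpos (sub_nonpos.2 h), zero_add, abs_of_nonpos (sub_nonpos.2 h),
      neg_sub]
  · rw [ENNReal.ofReal_of_nonpos (p := b - a) (sub_nonpos.2 h), add_zero,
      abs_of_nonneg (sub_nonneg.2 h)]

section Gaussian

variable (E : Type*) [NormedAddCommGroup E] [InnerProductSpace ℝ E] [FiniteDimensional ℝ E]
  [MeasurableSpace E] [BorelSpace E]

/-- The centered isotropic Gaussian law with standard deviation `σ`. -/
def isoGaussian (σ : ℝ) : Measure E := (stdGaussian E).map (σ • ·)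

instance (σ : ℝ) : IsProbabilityMeasure (isoGaussian E σ) :=
  Measure.isProbabilityMeasure_map (by fun_prop)

lemma charFun_isoGaussian (σ : ℝ) (t : E) :
    charFun (isoGaussian E σ) t = Complex.exp (-(σ ^ 2 * ‖t‖ ^ 2) / 2) := by
  rw [isoGaussian, charFun_map_smul, charFun_stdGaussian, norm_smul]
  simp [mul_pow, ← Complex.ofReal_pow]

lemma isoGaussian_conv {σ τ ρ : ℝ} (h : σ ^ 2 + τ ^ 2 = ρ ^ 2) :
    isoGaussian E σ ∗ isoGaussian E τ = isoGaussian E ρ := by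
  apply Measure.ext_of_charFun
  ext t
  rw [charFun_conv, charFun_isoGaussian, charFun_isoGaussian, charFun_isoGaussian,
    ← Complex.exp_add, ← Complex.ofReal_pow ρ, ← h]
  congr 1
  push_cast
  ring

lemma lintegral_norm_sq_stdGaussian :
    ∫⁻ z, ENNReal.ofReal (‖z‖ ^ 2) ∂(stdGaussian E) = Module.finrank ℝ E := by
  let b := stdOrthonormalBasis ℝ E
  have h : ∀ z : E, ENNReal.ofReal (‖z‖ ^ 2) = ∑ i, ENNReal.ofReal ((innerSL ℝ (b i) z) ^ 2) := by
    intro z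
    rw [← ENNReal.ofReal_sum_of_nonneg (fun _ _ => by positivity)]
    simp only [innerSL_apply_apply]
    rw [b.sum_sq_inner_right]
  simp_rw [h]
  rw [lintegral_finsetSum _ (by fun_prop)]
  have h1 : ∀ i, ∫⁻ z, ENNReal.ofReal ((innerSL ℝ (b i) z) ^ 2) ∂(stdGaussian E) = 1 := by
    intro i
    have hm : MemLp (innerSL ℝ (b i)) 2 (stdGaussian E) :=
      IsGaussian.memLp_dual _ _ 2 (by simp)
    rw [← ofReal_integral_eq_lintegral_ofReal hm.integrable_sq (by filter_upwards; intro; positivity)]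
    have := variance_dual_stdGaussian (E := E) (innerSL ℝ (b i))
    rw [variance_of_integral_eq_zero (by fun_prop) (integral_strongDual_stdGaussian _)] at this
    rw [this]
    simp
  rw [Finset.sum_congr rfl fun i _ => h1 i]
  simp

lemma lintegral_norm_rpow_isoGaussian_le {q : ℝ} (hq0 : 0 < q) (hq2 : q < 2) {σ : ℝ} (hσ : 0 ≤ σ) :
    ∫⁻ z, ENNReal.ofReal (‖z‖ ^ q) ∂(isoGaussian E σ) ≤
      ENNReal.ofReal ((Module.finrank ℝ E : ℝ) ^ (q / 2) * σ ^ q) := by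
  have h0 : ∫⁻ z, ENNReal.ofReal (‖z‖ ^ q) ∂(stdGaussian E) ≤
      (Module.finrank ℝ E : ℝ≥0∞) ^ (q / 2) := by
    have hp : 1 < 2 / q := by rw [lt_div_iff₀ hq0]; linarith
    have hpq : (2 / q).HolderConjugate (Real.conjExponent (2 / q)) :=
      Real.HolderConjugate.conjExponent hp
    have := ENNReal.lintegral_mul_le_Lp_mul_Lq (stdGaussian E) hpq
      (f := fun z => ENNReal.ofReal (‖z‖ ^ q)) (g := fun _ => 1) (by fun_prop) (by fun_prop)
    simp only [Pi.mul_apply, mul_one, ENNReal.one_rpow, lintegral_one, measure_univ] at this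
    refine this.trans (le_of_eq ?_)
    rw [← lintegral_norm_sq_stdGaussian, one_div_div]
    congr 2
    ext z
    rw [ENNReal.ofReal_rpow_of_nonneg (by positivity) (by positivity), ← Real.rpow_mul (norm_nonneg _),
      mul_div_cancel₀ _ hq0.ne']
    simp
  rw [isoGaussian, lintegral_map (by fun_prop) (by fun_prop)]
  have h1 : ∀ z : E, ENNReal.ofReal (‖σ • z‖ ^ q) =
      ENNReal.ofReal (σ ^ q) * ENNReal.ofReal (‖z‖ ^ q) := by
    intro z
    rw [← ENNReal.ofReal_mul (by positivity), norm_smul, Real.norm_of_nonneg hσ,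
      Real.mul_rpow hσ (norm_nonneg _)]
  simp_rw [h1]
  rw [lintegral_const_mul _ (by fun_prop), mul_comm ((Module.finrank ℝ E : ℝ) ^ (q / 2)),
    ENNReal.ofReal_mul (by positivity),
    ← ENNReal.ofReal_rpow_of_nonneg (x := (Module.finrank ℝ E : ℝ)) (by positivity) (by positivity),
    ENNReal.ofReal_natCast]
  gcongr

variable {E}

lemma integral_isoGaussianPDF {σ : ℝ} (hσ : 0 < σ) : ∫ z, isoGaussianPDF E σ z = 1 := by
  unfold isoGaussianPDF
  rw [integral_const_mul, GaussianFourier.integral_rexp_neg_mul_sq_norm (by positivity),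
    div_inv_eq_mul, show Real.pi * (2 * σ ^ 2) = 2 * Real.pi * σ ^ 2 by ring]
  exact inv_mul_cancel₀ (by positivity)

lemma integrable_isoGaussianPDF {σ : ℝ} (hσ : 0 < σ) : Integrable (isoGaussianPDF E σ) :=
  .of_integral_ne_zero (by rw [integral_isoGaussianPDF hσ]; exact one_ne_zero)

lemma lintegral_isoGaussianPDF_sub {σ : ℝ} (hσ : 0 < σ) (x : E) :
    ∫⁻ z, ENNReal.ofReal (isoGaussianPDF E σ (z - x)) = 1 := by
  rw [lintegral_sub_right_eq_self (fun z => ENNReal.ofReal (isoGaussianPDF E σ z)) x,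
    ← ofReal_integral_eq_lintegral_ofReal (integrable_isoGaussianPDF hσ)
    (.of_forall fun z => isoGaussianPDF_nonneg σ z), integral_isoGaussianPDF hσ, ENNReal.ofReal_one]

lemma isoGaussian_eq_withDensity {σ : ℝ} (hσ : 0 < σ) :
    isoGaussian E σ = volume.withDensity fun z => ENNReal.ofReal (isoGaussianPDF E σ z) := by
  have : IsFiniteMeasure (volume.withDensity fun z => ENNReal.ofReal (isoGaussianPDF E σ z)) :=
    isFiniteMeasure_withDensity_ofReal (integrable_isoGaussianPDF hσ).2
  apply Measure.ext_of_charFun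
  ext t
  rw [charFun_isoGaussian, charFun_apply, integral_withDensity_eq_integral_toReal_smul (by fun_prop)
    (.of_forall fun _ => ENNReal.ofReal_lt_top)]
  simp only [ENNReal.toReal_ofReal (isoGaussianPDF_nonneg _ _)]
  have h := GaussianFourier.integral_cexp_neg_mul_sq_norm_add (V := E)
    (b := (((2 * σ ^ 2)⁻¹ : ℝ) : ℂ)) (by rw [Complex.ofReal_re]; positivity) Complex.I t
  have h1 : ∀ z : E, isoGaussianPDF E σ z • Complex.exp ((inner ℝ z t : ℝ) * Complex.I) =
      ((((2 * Real.pi * σ ^ 2) ^ (Module.finrank ℝ E / 2 : ℝ))⁻¹ : ℝ) : ℂ) *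
      Complex.exp (-(((2 * σ ^ 2)⁻¹ : ℝ) : ℂ) * ‖z‖ ^ 2 + Complex.I * (inner ℝ t z : ℝ)) := by
    intro z
    rw [Complex.exp_add, isoGaussianPDF, Complex.real_smul, real_inner_comm, mul_comm Complex.I]
    push_cast
    ring
  simp_rw [h1]
  rw [integral_const_mul, h]
  have h2 : ((Real.pi : ℂ) / (((2 * σ ^ 2)⁻¹ : ℝ) : ℂ)) ^ (Module.finrank ℝ E / 2 : ℂ) =
      (((2 * Real.pi * σ ^ 2) ^ (Module.finrank ℝ E / 2 : ℝ) : ℝ) : ℂ) := by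
    rw [Complex.ofReal_cpow (by positivity)]
    push_cast
    congr 1
    rw [div_inv_eq_mul]
    ring
  rw [h2, ← mul_assoc, ← Complex.ofReal_mul, inv_mul_cancel₀ (by positivity), Complex.ofReal_one,
    one_mul, Complex.I_sq]
  congr 1
  have : (σ : ℂ) ≠ 0 := by exact_mod_cast hσ.ne'
  push_cast
  field_simp
  ring

@[fun_prop]
lemma measurable_smoothed (σ : ℝ) (P : Measure E) [SFinite P] : Measurable (smoothed σ P) :=
  Measurable.lintegral_prod_right'
    (f := fun p : E × E => ENNReal.ofReal (isoGaussianPDF E σ (p.1 - p.2))) (by fun_prop)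

lemma withDensity_smoothed {σ : ℝ} (hσ : 0 < σ) (P : Measure E) [SFinite P] :
    volume.withDensity (smoothed σ P) = P ∗ isoGaussian E σ := by
  ext A hA
  have hf : Measurable (A.indicator (1 : E → ℝ≥0∞)) := measurable_one.indicator hA
  rw [← lintegral_indicator_one hA, ← lintegral_indicator_one hA,
    Measure.lintegral_conv hf, isoGaussian_eq_withDensity hσ,
    lintegral_withDensity_eq_lintegral_mul _ (by fun_prop) hf]
  have h1 : ∀ z, smoothed σ P z * A.indicator (1 : E → ℝ≥0∞) z =
      ∫⁻ x, ENNReal.ofReal (isoGaussianPDF E σ (z - x)) * A.indicator (1 : E → ℝ≥0∞) z ∂P := by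
    intro z
    rw [lintegral_mul_const _ (by fun_prop)]
    rfl
  simp_rw [Pi.mul_apply, h1]
  rw [lintegral_lintegral_swap (by fun_prop)]
  congr with x
  rw [lintegral_withDensity_eq_lintegral_mul _ (by fun_prop) (by fun_prop),
    ← lintegral_sub_right_eq_self (fun a => (_ * fun y => A.indicator (1 : E → ℝ≥0∞) (x + y)) a) x]
  simp

/-- The `L¹` distance of two extended nonnegative functions. -/
def lDist (f g : E → ℝ≥0∞) : ℝ≥0∞ := ∫⁻ z, (f z - g z + (g z - f z))

lemma lDist_isoGaussianPDF_le_two {σ : ℝ} (hσ : 0 < σ) (x y : E) :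
    lDist (fun z => ENNReal.ofReal (isoGaussianPDF E σ (z - x)))
      (fun z => ENNReal.ofReal (isoGaussianPDF E σ (z - y))) ≤ 2 := by
  refine (lintegral_mono fun z => add_le_add tsub_le_self tsub_le_self).trans ?_
  rw [lintegral_add_left (by fun_prop), lintegral_isoGaussianPDF_sub hσ,
    lintegral_isoGaussianPDF_sub hσ]
  norm_num

lemma lDist_isoGaussianPDF_le {σ : ℝ} (hσ : 0 < σ) (x y : E) :
    lDist (fun z => ENNReal.ofReal (isoGaussianPDF E σ (z - x)))
      (fun z => ENNReal.ofReal (isoGaussianPDF E σ (z - y))) ≤ ENNReal.ofReal (‖x - y‖ / σ) := by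
  rcases eq_or_ne x y with rfl | hxy
  · simp [lDist]
  set D := ‖x - y‖ / σ with hDdef
  have hD : 0 < D := div_pos (norm_pos_iff.2 (sub_ne_zero.2 hxy)) hσ
  set e := Real.exp (-(‖x - y‖ ^ 2 / (8 * σ ^ 2))) with he
  have he1 : 1 - D ^ 2 / 8 ≤ e := by
    have := Real.add_one_le_exp (-(‖x - y‖ ^ 2 / (8 * σ ^ 2)))
    have h2 : D ^ 2 / 8 = ‖x - y‖ ^ 2 / (8 * σ ^ 2) := by
      rw [hDdef, div_pow, div_div, mul_comm]
    linarith
  have he2 : e ≤ 1 := Real.exp_le_one_iff.2 (neg_nonpos.2 (by positivity))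
  have hi : ∀ w : E, Integrable fun z => isoGaussianPDF E σ (z - w) :=
    fun w => (integrable_isoGaussianPDF hσ).comp_sub_right w
  have hi1 : ∀ w : E, ∫ z, isoGaussianPDF E σ (z - w) = 1 := fun w => by
    rw [integral_sub_right_eq_self (isoGaussianPDF E σ) w, integral_isoGaussianPDF hσ]
  let m : E → ℝ := fun z => isoGaussianPDF E σ (z - (2⁻¹ : ℝ) • (x + y)) * e
  have hmi : Integrable m := (hi _).mul_const e
  have hm1 : ∫ z, m z = e := by simp only [m]; rw [integral_mul_const, hi1, one_mul]
  have hab : Integrable fun z => isoGaussianPDF E σ (z - x) + isoGaussianPDF E σ (z - y) :=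
    (hi x).add (hi y)
  have hI1 : Integrable fun z =>
      2 / D * (isoGaussianPDF E σ (z - x) + isoGaussianPDF E σ (z - y) - 2 * m z) :=
    (hab.sub (hmi.const_mul 2)).const_mul (2 / D)
  have hI2 : Integrable fun z =>
      D / 8 * (isoGaussianPDF E σ (z - x) + isoGaussianPDF E σ (z - y) + 2 * m z) :=
    (hab.add (hmi.const_mul 2)).const_mul (D / 8)
  have hI : Integrable fun z =>
      2 / D * (isoGaussianPDF E σ (z - x) + isoGaussianPDF E σ (z - y) - 2 * m z) +
      D / 8 * (isoGaussianPDF E σ (z - x) + isoGaussianPDF E σ (z - y) + 2 * m z) := hI1.add hI2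
  have hpt : ∀ z, |isoGaussianPDF E σ (z - x) - isoGaussianPDF E σ (z - y)| ≤
      2 / D * (isoGaussianPDF E σ (z - x) + isoGaussianPDF E σ (z - y) - 2 * m z) +
      D / 8 * (isoGaussianPDF E σ (z - x) + isoGaussianPDF E σ (z - y) + 2 * m z) := fun z =>
    abs_sub_le_of_mul_eq_sq (isoGaussianPDF_nonneg _ _) (isoGaussianPDF_nonneg _ _)
      (mul_nonneg (isoGaussianPDF_nonneg _ _) (Real.exp_pos _).le) hD (isoGaussianPDF_mul σ x y z)
  have h_int : ∫ z, (2 / D * (isoGaussianPDF E σ (z - x) + isoGaussianPDF E σ (z - y) - 2 * m z) +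
      D / 8 * (isoGaussianPDF E σ (z - x) + isoGaussianPDF E σ (z - y) + 2 * m z)) ≤ D := by
    have : ∫ z, (2 / D * (isoGaussianPDF E σ (z - x) + isoGaussianPDF E σ (z - y) - 2 * m z) +
        D / 8 * (isoGaussianPDF E σ (z - x) + isoGaussianPDF E σ (z - y) + 2 * m z)) =
        2 / D * (1 + 1 - 2 * e) + D / 8 * (1 + 1 + 2 * e) := by
      rw [integral_add hI1 hI2, integral_const_mul, integral_const_mul,
        integral_sub hab (hmi.const_mul 2), integral_add hab (hmi.const_mul 2),
        integral_add (hi x) (hi y), integral_const_mul, hi1, hi1, hm1]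
    rw [this]
    have h3 : 2 / D * (1 + 1 - 2 * e) ≤ 2 / D * (D ^ 2 / 4) := by
      gcongr; linarith
    have h4 : 2 / D * (D ^ 2 / 4) = D / 2 := by field_simp; norm_num
    nlinarith
  unfold lDist
  simp_rw [ofReal_sub_add_ofReal_sub _ _ (isoGaussianPDF_nonneg _ _) (isoGaussianPDF_nonneg _ _)]
  refine (lintegral_mono fun z => ENNReal.ofReal_le_ofReal (hpt z)).trans ?_
  rw [← ofReal_integral_eq_lintegral_ofReal hI
    (.of_forall fun z => (abs_nonneg _).trans (hpt z))]
  exact ENNReal.ofReal_le_ofReal h_int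

end Gaussian


section DyadicSum

lemma inv_one_sub_two_rpow_neg_le {a : ℝ} (ha : 0 < a) : (1 - (2 : ℝ) ^ (-a))⁻¹ ≤ 1 + 2 / a := by
  have h1 : 1 + a / 2 ≤ (2 : ℝ) ^ a := by
    rw [Real.rpow_def_of_pos two_pos]
    have := Real.add_one_le_exp (Real.log 2 * a)
    nlinarith [Real.log_two_gt_d9]
  have h2 : (2 : ℝ) ^ (-a) ≤ (1 + a / 2)⁻¹ := by
    rw [Real.rpow_neg two_pos.le]
    gcongr
  have h3 : 1 - (1 + a / 2)⁻¹ = (1 + 2 / a)⁻¹ := by field_simp; ring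
  rw [inv_le_comm₀ (by have : (1 + a / 2)⁻¹ < 1 := inv_lt_one_of_one_lt₀ (by linarith)
                       linarith) (by positivity)]
  linarith

/-- Summing the two competing bounds for the total variation distance of Gaussians over all
dyadic scales. -/
lemma tsum_dyadic_le {q : ℝ} (hq0 : 0 < q) (hq1 : q < 1) {D : ℝ} (hD : 0 ≤ D) :
    ∑' k : ℤ, ENNReal.ofReal ((2 : ℝ) ^ (k + 1)) *
      min 2 (ENNReal.ofReal (D / (2 : ℝ) ^ ((k : ℝ) / q))) ≤
      ENNReal.ofReal (10 / (1 - q) * D ^ q) := by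
  rcases hD.eq_or_lt with rfl | hD
  · simp
  obtain ⟨m, hm1, hm2⟩ := exists_mem_Ico_zpow (x := D ^ q) (y := 2) (by positivity) one_lt_two
  set a : ℝ := (1 - q) / q with ha_def
  have ha : 0 < a := div_pos (by linarith) hq0
  set ρ : ℝ := (2 : ℝ) ^ (-a) with hρ_def
  have hρ0 : 0 ≤ ρ := by positivity
  have hρ1 : ρ < 1 := Real.rpow_lt_one_of_one_lt_of_neg one_lt_two (by linarith)
  have hlow : ∀ i : ℕ, ENNReal.ofReal ((2 : ℝ) ^ (-((i : ℤ) + 1) + (m + 1) + 1)) *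
      min 2 (ENNReal.ofReal (D / (2 : ℝ) ^ (((-((i : ℤ) + 1) + (m + 1) : ℤ) : ℝ) / q))) ≤
      ENNReal.ofReal (4 * D ^ q * (1 / 2) ^ i) := by
    intro i
    refine (mul_le_mul_right (min_le_left _ _) _).trans ?_
    rw [show (2 : ℝ≥0∞) = ENNReal.ofReal 2 by simp, ← ENNReal.ofReal_mul (by positivity)]
    apply ENNReal.ofReal_le_ofReal
    rw [show -((i : ℤ) + 1) + (m + 1) + 1 = m + 1 - i by ring, zpow_sub₀ two_ne_zero,
      zpow_add_one₀ two_ne_zero, zpow_natCast, one_div, inv_pow, div_eq_mul_inv]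
    have : 0 ≤ ((2 : ℝ) ^ i)⁻¹ := by positivity
    nlinarith
  have hhigh : ∀ i : ℕ, ENNReal.ofReal ((2 : ℝ) ^ ((i : ℤ) + (m + 1) + 1)) *
      min 2 (ENNReal.ofReal (D / (2 : ℝ) ^ ((((i : ℤ) + (m + 1) : ℤ) : ℝ) / q))) ≤
      ENNReal.ofReal (2 * D ^ q * ρ ^ i) := by
    intro i
    refine (mul_le_mul_right (min_le_right _ _) _).trans ?_
    rw [← ENNReal.ofReal_mul (by positivity)]
    apply ENNReal.ofReal_le_ofReal
    have h1 : D = D ^ q * (D ^ q) ^ a := by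
      rw [← Real.rpow_mul hD.le, ← Real.rpow_add hD, ha_def, mul_div_cancel₀ _ hq0.ne',
        add_sub_cancel, Real.rpow_one]
    have h2 : (D ^ q) ^ a ≤ ((2 : ℝ) ^ ((m : ℝ) + 1)) ^ a := by
      gcongr
      exact_mod_cast hm2.le
    rw [← Real.rpow_mul two_pos.le] at h2
    have h3 : (2 : ℝ) ^ ((i : ℤ) + (m + 1) + 1) = (2 : ℝ) ^ ((i : ℝ) + (m + 1) + 1) := by
      exact_mod_cast (Real.rpow_intCast (2 : ℝ) ((i : ℤ) + (m + 1) + 1)).symm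
    calc (2 : ℝ) ^ ((i : ℤ) + (m + 1) + 1) *
          (D / (2 : ℝ) ^ ((((i : ℤ) + (m + 1) : ℤ) : ℝ) / q))
        = D ^ q * ((2 : ℝ) ^ ((i : ℝ) + (m + 1) + 1) * (D ^ q) ^ a *
          (2 : ℝ) ^ (-(((i : ℝ) + (m + 1)) / q))) := by
          rw [h3, Real.rpow_neg two_pos.le]
          nth_rewrite 1 [h1]
          push_cast
          ring
      _ ≤ D ^ q * ((2 : ℝ) ^ ((i : ℝ) + (m + 1) + 1) * (2 : ℝ) ^ (((m : ℝ) + 1) * a) *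
          (2 : ℝ) ^ (-(((i : ℝ) + (m + 1)) / q))) := by gcongr
      _ = D ^ q * (2 : ℝ) ^ (1 + -a * i) := by
          rw [← Real.rpow_add two_pos, ← Real.rpow_add two_pos, ha_def]
          congr 2
          field_simp
          ring
      _ = 2 * D ^ q * ρ ^ i := by
          rw [Real.rpow_add two_pos, Real.rpow_one, Real.rpow_mul two_pos.le, Real.rpow_natCast]
          ring
  rw [← (Equiv.addRight (m + 1)).tsum_eq, tsum_of_nat_of_neg_add_one ENNReal.summable
    ENNReal.summable]
  simp only [Equiv.coe_addRight]
  refine (add_le_add (ENNReal.tsum_le_tsum hhigh) (ENNReal.tsum_le_tsum hlow)).trans ?_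
  have hg1 := summable_geometric_of_lt_one hρ0 hρ1
  have hg2 := summable_geometric_two
  rw [← ENNReal.ofReal_tsum_of_nonneg (fun i => by positivity) (hg1.mul_left _),
    ← ENNReal.ofReal_tsum_of_nonneg (fun i => by positivity) (hg2.mul_left _),
    tsum_mul_left, tsum_mul_left, tsum_geometric_of_lt_one hρ0 hρ1, tsum_geometric_two,
    ← ENNReal.ofReal_add
      (mul_nonneg (by positivity) (inv_nonneg.2 (by linarith))) (by positivity)]
  apply ENNReal.ofReal_le_ofReal
  have h4 := inv_one_sub_two_rpow_neg_le ha
  have h5 : 8 + 2 * (1 + 2 / a) ≤ 10 / (1 - q) := by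
    have h6 : (0 : ℝ) < 1 - q := by linarith
    rw [ha_def, le_div_iff₀ h6]
    field_simp
    nlinarith
  have h7 : 0 ≤ D ^ q := by positivity
  calc 2 * D ^ q * (1 - ρ)⁻¹ + 4 * D ^ q * 2 = (8 + 2 * (1 - ρ)⁻¹) * D ^ q := by ring
    _ ≤ 10 / (1 - q) * D ^ q := by
      gcongr
      linarith

end DyadicSum

section MultiscaleDist

variable {E : Type*} [NormedAddCommGroup E] [InnerProductSpace ℝ E] [FiniteDimensional ℝ E]
  [MeasurableSpace E] [BorelSpace E]

/-- The standard deviation of the `k`-th scale, chosen so that `gaussianScale q k ^ q = 2 ^ k`. -/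
def gaussianScale (q : ℝ) (k : ℤ) : ℝ := 2 ^ ((k : ℝ) / q)

lemma gaussianScale_pos (q : ℝ) (k : ℤ) : 0 < gaussianScale q k := by
  unfold gaussianScale; positivity

lemma gaussianScale_rpow {q : ℝ} (hq : 0 < q) (k : ℤ) : gaussianScale q k ^ q = 2 ^ k := by
  rw [gaussianScale, ← Real.rpow_mul two_pos.le, div_mul_cancel₀ _ hq.ne', Real.rpow_intCast]

lemma gaussianScale_le_succ {q : ℝ} (hq : 0 < q) (k : ℤ) :
    gaussianScale q k ≤ gaussianScale q (k + 1) := by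
  unfold gaussianScale
  gcongr
  · exact one_le_two
  · omega

/-- The weighted sum over all dyadic scales of the `L¹` distances of Gaussian smoothings. -/
def multiscaleDist (q : ℝ) (P Q : Measure E) : ℝ≥0∞ :=
  ∑' k : ℤ, ENNReal.ofReal ((Module.finrank ℝ E : ℝ) ^ (q / 2) * 2 ^ (k + 1)) *
    lDist (smoothed (gaussianScale q k) P) (smoothed (gaussianScale q k) Q)

lemma lDist_smoothed_le (σ : ℝ) (γ : Measure (E × E)) [SFinite γ] :
    lDist (smoothed σ (γ.map Prod.fst)) (smoothed σ (γ.map Prod.snd)) ≤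
      ∫⁻ p, lDist (fun z => ENNReal.ofReal (isoGaussianPDF E σ (z - p.1)))
        (fun z => ENNReal.ofReal (isoGaussianPDF E σ (z - p.2))) ∂γ := by
  unfold lDist
  rw [lintegral_lintegral_swap (by fun_prop)]
  refine lintegral_mono fun z => ?_
  rw [lintegral_add_left (by fun_prop)]
  have h1 : smoothed σ (γ.map Prod.fst) z =
      ∫⁻ p, ENNReal.ofReal (isoGaussianPDF E σ (z - p.1)) ∂γ :=
    lintegral_map (f := fun x => ENNReal.ofReal (isoGaussianPDF E σ (z - x)))
      (by fun_prop) measurable_fst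
  have h2 : smoothed σ (γ.map Prod.snd) z =
      ∫⁻ p, ENNReal.ofReal (isoGaussianPDF E σ (z - p.2)) ∂γ :=
    lintegral_map (f := fun x => ENNReal.ofReal (isoGaussianPDF E σ (z - x)))
      (by fun_prop) measurable_snd
  rw [h1, h2]
  exact add_le_add (lintegral_sub_le _ _ (by fun_prop)) (lintegral_sub_le _ _ (by fun_prop))

lemma measurable_lDist_isoGaussianPDF (σ : ℝ) : Measurable fun p : E × E =>
    lDist (fun z => ENNReal.ofReal (isoGaussianPDF E σ (z - p.1)))
      (fun z => ENNReal.ofReal (isoGaussianPDF E σ (z - p.2))) :=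
  Measurable.lintegral_prod_right' (f := fun r : (E × E) × E =>
    ENNReal.ofReal (isoGaussianPDF E σ (r.2 - r.1.1)) -
      ENNReal.ofReal (isoGaussianPDF E σ (r.2 - r.1.2)) +
    (ENNReal.ofReal (isoGaussianPDF E σ (r.2 - r.1.2)) -
      ENNReal.ofReal (isoGaussianPDF E σ (r.2 - r.1.1)))) (by fun_prop)

lemma multiscaleDist_le_lintegral {q : ℝ} (hq0 : 0 < q) (hq1 : q < 1) (γ : Measure (E × E))
    [SFinite γ] :
    multiscaleDist q (γ.map Prod.fst) (γ.map Prod.snd) ≤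
      ENNReal.ofReal (10 * (Module.finrank ℝ E : ℝ) ^ (q / 2) / (1 - q)) *
        ∫⁻ p, ENNReal.ofReal (‖p.1 - p.2‖ ^ q) ∂γ := by
  unfold multiscaleDist
  calc _ ≤ ∑' k : ℤ, ∫⁻ p, ENNReal.ofReal ((Module.finrank ℝ E : ℝ) ^ (q / 2) * 2 ^ (k + 1)) *
          lDist (fun z => ENNReal.ofReal (isoGaussianPDF E (gaussianScale q k) (z - p.1)))
            (fun z => ENNReal.ofReal (isoGaussianPDF E (gaussianScale q k) (z - p.2))) ∂γ := by
        refine ENNReal.tsum_le_tsum fun k => ?_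
        rw [lintegral_const_mul _ (measurable_lDist_isoGaussianPDF _)]
        gcongr
        exact lDist_smoothed_le _ _
    _ = ∫⁻ p, ∑' k : ℤ, ENNReal.ofReal ((Module.finrank ℝ E : ℝ) ^ (q / 2) * 2 ^ (k + 1)) *
          lDist (fun z => ENNReal.ofReal (isoGaussianPDF E (gaussianScale q k) (z - p.1)))
            (fun z => ENNReal.ofReal (isoGaussianPDF E (gaussianScale q k) (z - p.2))) ∂γ :=
        (lintegral_tsum fun k =>
          ((measurable_lDist_isoGaussianPDF _).const_mul _).aemeasurable).symm
    _ ≤ _ := by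
        rw [← lintegral_const_mul _ (by fun_prop)]
        refine lintegral_mono fun p => ?_
        have h := tsum_dyadic_le hq0 hq1 (norm_nonneg (p.1 - p.2))
        calc _ ≤ ∑' k : ℤ, ENNReal.ofReal ((Module.finrank ℝ E : ℝ) ^ (q / 2)) *
                (ENNReal.ofReal (2 ^ (k + 1)) *
                  min 2 (ENNReal.ofReal (‖p.1 - p.2‖ / (2 : ℝ) ^ ((k : ℝ) / q)))) := by
              refine ENNReal.tsum_le_tsum fun k => ?_
              rw [ENNReal.ofReal_mul (by positivity), mul_assoc]
              gcongr
              exact le_min (lDist_isoGaussianPDF_le_two (gaussianScale_pos q k) _ _)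
                (lDist_isoGaussianPDF_le (gaussianScale_pos q k) _ _)
          _ ≤ ENNReal.ofReal ((Module.finrank ℝ E : ℝ) ^ (q / 2)) *
                ENNReal.ofReal (10 / (1 - q) * ‖p.1 - p.2‖ ^ q) := by
              rw [ENNReal.tsum_mul_left]
              gcongr
          _ = _ := by
              have : (0 : ℝ) ≤ 10 / (1 - q) := div_nonneg (by norm_num) (by linarith)
              rw [← ENNReal.ofReal_mul (by positivity), ← ENNReal.ofReal_mul (by positivity)]
              congr 1
              ring

end MultiscaleDist

section NoiseFlow

variable {E : Type*} [NormedAddCommGroup E] [InnerProductSpace ℝ E] [FiniteDimensional ℝ E]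
  [MeasurableSpace E] [BorelSpace E]

/-- The flow moving the mass `a` to `a ∗ L` by adding independent noise of law `L`. -/
def noiseFlow (a L : Measure E) : Measure (E × E) := (a.prod L).map fun p => (p.1, p.1 + p.2)

lemma noiseFlow_fst (a L : Measure E) [SFinite a] [IsProbabilityMeasure L] :
    (noiseFlow a L).fst = a := by
  rw [Measure.fst, noiseFlow, Measure.map_map measurable_fst (by fun_prop)]
  exact Measure.fst_prod

lemma noiseFlow_snd (a L : Measure E) : (noiseFlow a L).snd = a ∗ L := by
  rw [Measure.snd, noiseFlow, Measure.map_map measurable_snd (by fun_prop)]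
  rfl

lemma noiseFlow_univ (a L : Measure E) [SFinite a] [IsProbabilityMeasure L] :
    noiseFlow a L Set.univ = a Set.univ := by
  rw [← Measure.fst_univ, noiseFlow_fst]

lemma lintegral_noiseFlow (q : ℝ) (a L : Measure E) [SFinite L] :
    ∫⁻ p, ENNReal.ofReal (‖p.1 - p.2‖ ^ q) ∂(noiseFlow a L) =
      (∫⁻ z, ENNReal.ofReal (‖z‖ ^ q) ∂L) * a Set.univ := by
  rw [noiseFlow, lintegral_map (by fun_prop) (by fun_prop)]
  simp only [sub_add_cancel_left, norm_neg]
  rw [lintegral_prod _ (by fun_prop)]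
  simp only
  rw [lintegral_const]

lemma lintegral_noiseFlow_swap (q : ℝ) (a L : Measure E) [SFinite L] :
    ∫⁻ p, ENNReal.ofReal (‖p.1 - p.2‖ ^ q) ∂((noiseFlow a L).map Prod.swap) =
      (∫⁻ z, ENNReal.ofReal (‖z‖ ^ q) ∂L) * a Set.univ := by
  rw [lintegral_map (by fun_prop) measurable_swap, ← lintegral_noiseFlow]
  simp [norm_sub_rev]

/-- Positive part of `f - g` as a measure. -/
def excess (f g : E → ℝ≥0∞) : Measure E := volume.withDensity (f - g)

lemma excess_add {f g : E → ℝ≥0∞} (hf : Measurable f) (hg : Measurable g) :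
    excess f g + volume.withDensity g = excess g f + volume.withDensity f := by
  unfold excess
  rw [← withDensity_add_right _ hg, ← withDensity_add_right _ hf]
  congr 1
  ext z
  simp only [Pi.add_apply, Pi.sub_apply]
  rw [tsub_add_eq_max, tsub_add_eq_max, max_comm]

lemma excess_univ_add {f g : E → ℝ≥0∞} (hf : Measurable f) (hg : Measurable g) :
    excess f g Set.univ + excess g f Set.univ = lDist f g := by
  unfold excess lDist
  rw [withDensity_apply _ .univ, withDensity_apply _ .univ, Measure.restrict_univ,
    lintegral_add_left (by fun_prop)]
  rfl

instance (f g : E → ℝ≥0∞) : SFinite (excess f g) := by unfold excess; infer_instance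

/-- Telescoping identity behind the balance of the flow in `exists_flow`. -/
lemma tsum_balance {a a' b b' p r : ℕ → ℝ≥0∞} (hp : ∀ j, p j ≠ ⊤) (hr : ∀ j, r j ≠ ⊤)
    (h1 : ∀ j, a j + r j = b j + p j)
    (h2 : ∀ j, a' j + r (j + 1) = b' j + p (j + 1)) :
    r 0 + ∑' j, (a j + b' j) = p 0 + ∑' j, (a' j + b j) := by
  have h3 : ∀ j, a' j + b (j + 1) = b' j + a (j + 1) := by
    intro j
    have h4 : a' j + b (j + 1) + (r (j + 1) + p (j + 1)) =
        b' j + a (j + 1) + (r (j + 1) + p (j + 1)) := by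
      calc _ = (a' j + r (j + 1)) + (b (j + 1) + p (j + 1)) := by ring
        _ = (b' j + p (j + 1)) + (a (j + 1) + r (j + 1)) := by rw [h2, h1]
        _ = _ := by ring
    exact (ENNReal.add_left_inj (ENNReal.add_ne_top.2 ⟨hr _, hp _⟩)).1 h4
  have h5 : ∑' j, a' j + ∑' j, b (j + 1) = ∑' j, b' j + ∑' j, a (j + 1) := by
    rw [← ENNReal.tsum_add, ← ENNReal.tsum_add]
    exact tsum_congr h3
  rw [ENNReal.tsum_add, ENNReal.tsum_add, tsum_eq_zero_add' (f := a) ENNReal.summable,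
    tsum_eq_zero_add' (f := b) ENNReal.summable]
  calc _ = (a 0 + r 0) + (∑' j, b' j + ∑' j, a (j + 1)) := by ring
    _ = (b 0 + p 0) + (∑' j, a' j + ∑' j, b (j + 1)) := by rw [h1, h5]
    _ = _ := by ring

lemma sqrt_sq_sub_sq_le {σ ρ : ℝ} (hρ : 0 ≤ ρ) : √(ρ ^ 2 - σ ^ 2) ≤ ρ :=
  Real.sqrt_le_iff.2 ⟨hρ, by nlinarith [sq_nonneg σ]⟩

/-- A flow from `P` to `Q`: first smooth both measures at scale `m`, then repeatedly
move the difference of the smoothings at one scale to the next. -/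
lemma exists_flow [Nontrivial E] {q : ℝ} (hq0 : 0 < q) (hq1 : q < 1) (P Q : Measure E)
    [IsProbabilityMeasure P] [IsProbabilityMeasure Q] (hS : multiscaleDist q P Q ≠ ⊤) (m : ℤ) :
    ∃ γ : Measure (E × E), IsFiniteMeasure γ ∧ γ.fst + Q = γ.snd + P ∧
      ∫⁻ p, ENNReal.ofReal (‖p.1 - p.2‖ ^ q) ∂γ ≤
        2 * ENNReal.ofReal ((Module.finrank ℝ E : ℝ) ^ (q / 2) * 2 ^ m) +
          multiscaleDist q P Q := by
  set K : ℝ := (Module.finrank ℝ E : ℝ) ^ (q / 2) with hK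
  have hK0 : 0 < K := Real.rpow_pos_of_pos (by exact_mod_cast Module.finrank_pos) _
  let k : ℕ → ℤ := fun j => m + j
  have hk : Function.Injective k := fun i j h => by simpa [k] using h
  let σ : ℕ → ℝ := fun j => gaussianScale q (k j)
  have hσ : ∀ j, 0 < σ j := fun j => gaussianScale_pos _ _
  have hσ' : ∀ j, σ j ≤ σ (j + 1) := fun j => by
    have := gaussianScale_le_succ hq0 (k j)
    simpa [σ, k, add_assoc] using this
  have hσq : ∀ j, σ (j + 1) ^ q = 2 ^ (k j + 1) := fun j => by
    rw [gaussianScale_rpow hq0]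
    simp [k, add_assoc]
  let L : ℕ → Measure E := fun j => isoGaussian E (√(σ (j + 1) ^ 2 - σ j ^ 2))
  have hL : ∀ j, IsProbabilityMeasure (L j) := fun j => by infer_instance
  let f : ℕ → E → ℝ≥0∞ := fun j => smoothed (σ j) P
  let g : ℕ → E → ℝ≥0∞ := fun j => smoothed (σ j) Q
  have hf : ∀ j, Measurable (f j) := fun j => measurable_smoothed _ _
  have hg : ∀ j, Measurable (g j) := fun j => measurable_smoothed _ _
  have hstep : ∀ (R : Measure E) [IsProbabilityMeasure R] (j : ℕ),
      (R ∗ isoGaussian E (σ j)) ∗ L j = R ∗ isoGaussian E (σ (j + 1)) := by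
    intro R _ j
    rw [Measure.conv_assoc, isoGaussian_conv E]
    rw [Real.sq_sqrt (sub_nonneg.2 (pow_le_pow_left₀ (hσ j).le (hσ' j) 2))]
    ring
  let a : ℕ → Measure E := fun j => excess (f j) (g j)
  let b : ℕ → Measure E := fun j => excess (g j) (f j)
  have hab : ∀ j, a j Set.univ + b j Set.univ = lDist (f j) (g j) := fun j =>
    excess_univ_add (hf j) (hg j)
  have hbal1 : ∀ j, a j + Q ∗ isoGaussian E (σ j) = b j + P ∗ isoGaussian E (σ j) := by
    intro j
    rw [← withDensity_smoothed (hσ j), ← withDensity_smoothed (hσ j)]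
    exact excess_add (hf j) (hg j)
  have hbal2 : ∀ j, a j ∗ L j + Q ∗ isoGaussian E (σ (j + 1)) =
      b j ∗ L j + P ∗ isoGaussian E (σ (j + 1)) := by
    intro j
    rw [← hstep, ← hstep, ← Measure.add_conv, ← Measure.add_conv, hbal1]
  have hcost : ∀ j, ∫⁻ z, ENNReal.ofReal (‖z‖ ^ q) ∂(L j) ≤ ENNReal.ofReal (K * 2 ^ (k j + 1)) := by
    intro j
    refine (lintegral_norm_rpow_isoGaussian_le E hq0 (by linarith) (Real.sqrt_nonneg _)).trans ?_
    apply ENNReal.ofReal_le_ofReal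
    rw [← hσq]
    gcongr
    exact sqrt_sq_sub_sq_le (hσ _).le
  have hcost0 : ∫⁻ z, ENNReal.ofReal (‖z‖ ^ q) ∂(isoGaussian E (σ 0)) ≤
      ENNReal.ofReal (K * 2 ^ m) := by
    refine (lintegral_norm_rpow_isoGaussian_le E hq0 (by linarith) (hσ 0).le).trans ?_
    rw [gaussianScale_rpow hq0]
    simp [k, hK]
  have hsum : ∑' j, ENNReal.ofReal (K * 2 ^ (k j + 1)) * lDist (f j) (g j) ≤
      multiscaleDist q P Q :=
    ENNReal.tsum_comp_le_tsum_of_injective hk (fun i : ℤ => ENNReal.ofReal (K * 2 ^ (i + 1)) *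
      lDist (smoothed (gaussianScale q i) P) (smoothed (gaussianScale q i) Q))
  have hmass : ∑' j, lDist (f j) (g j) ≠ ⊤ := by
    have h1 : ENNReal.ofReal (K * 2 ^ m) * ∑' j, lDist (f j) (g j) ≠ ⊤ := by
      refine ne_top_of_le_ne_top hS (le_trans ?_ hsum)
      rw [← ENNReal.tsum_mul_left]
      refine ENNReal.tsum_le_tsum fun j => ?_
      gcongr
      · exact one_le_two
      · simp only [k]; omega
    exact (ENNReal.lt_top_of_mul_ne_top_right h1
      (ENNReal.ofReal_pos.2 (by positivity)).ne').ne
  let γ : Measure (E × E) := noiseFlow P (isoGaussian E (σ 0)) +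
    (noiseFlow Q (isoGaussian E (σ 0))).map Prod.swap +
    Measure.sum fun j => noiseFlow (a j) (L j) + (noiseFlow (b j) (L j)).map Prod.swap
  have hfst : γ.fst = P + Q ∗ isoGaussian E (σ 0) + Measure.sum fun j => a j + b j ∗ L j := by
    have h1 : ∀ j, (noiseFlow (a j) (L j) + (noiseFlow (b j) (L j)).map Prod.swap).fst =
        a j + b j ∗ L j := fun j => by
      rw [Measure.fst_add, noiseFlow_fst, Measure.fst_map_swap, noiseFlow_snd]
    rw [Measure.fst_add, Measure.fst_add, noiseFlow_fst, Measure.fst_map_swap, noiseFlow_snd,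
      Measure.fst_sum]
    simp_rw [h1]
  have hsnd : γ.snd = P ∗ isoGaussian E (σ 0) + Q + Measure.sum fun j => a j ∗ L j + b j := by
    have h1 : ∀ j, (noiseFlow (a j) (L j) + (noiseFlow (b j) (L j)).map Prod.swap).snd =
        a j ∗ L j + b j := fun j => by
      rw [Measure.snd_add, noiseFlow_snd, Measure.snd_map_swap, noiseFlow_fst]
    rw [Measure.snd_add, Measure.snd_add, noiseFlow_snd, Measure.snd_map_swap, noiseFlow_fst,
      Measure.snd_sum]
    simp_rw [h1]
  refine ⟨γ, ⟨?_⟩, ?_, ?_⟩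
  · rw [← Measure.fst_univ, hfst, Measure.add_apply, Measure.sum_apply _ .univ]
    simp only [Measure.add_apply]
    have h1 : ∀ j, a j Set.univ + (b j ∗ L j) Set.univ = lDist (f j) (g j) := fun j => by
      rw [← noiseFlow_snd, Measure.snd_univ, noiseFlow_univ, hab]
    simp_rw [h1]
    exact ENNReal.add_lt_top.2 ⟨ENNReal.add_lt_top.2 ⟨measure_lt_top _ _, measure_lt_top _ _⟩,
      hmass.lt_top⟩
  · rw [hfst, hsnd]
    ext s hs
    simp only [Measure.add_apply, Measure.sum_apply _ hs]
    have := tsum_balance (a := fun j => a j s) (a' := fun j => (a j ∗ L j) s)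
      (b := fun j => b j s) (b' := fun j => (b j ∗ L j) s)
      (p := fun j => (P ∗ isoGaussian E (σ j)) s) (r := fun j => (Q ∗ isoGaussian E (σ j)) s)
      (fun j => measure_ne_top _ _) (fun j => measure_ne_top _ _)
      (fun j => by simpa using congrArg (· s) (hbal1 j))
      (fun j => by simpa using congrArg (· s) (hbal2 j))
    calc _ = P s + Q s + ((Q ∗ isoGaussian E (σ 0)) s + ∑' j, (a j s + (b j ∗ L j) s)) := by ring
      _ = P s + Q s + ((P ∗ isoGaussian E (σ 0)) s + ∑' j, ((a j ∗ L j) s + b j s)) := by rw [this]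
      _ = _ := by ring
  · rw [lintegral_add_measure, lintegral_add_measure, lintegral_sum_measure, lintegral_noiseFlow,
      lintegral_noiseFlow_swap, measure_univ, measure_univ, mul_one, two_mul]
    refine add_le_add (add_le_add hcost0 hcost0) (le_trans ?_ hsum)
    refine ENNReal.tsum_le_tsum fun j => ?_
    rw [lintegral_add_measure, lintegral_noiseFlow, lintegral_noiseFlow_swap, ← mul_add, hab]
    gcongr
    exact hcost j

theorem Cstar_le_multiscaleDist [Nontrivial E] {q : ℝ} (hq0 : 0 < q) (hq1 : q < 1)
    (P Q : Measure E) [IsProbabilityMeasure P] [IsProbabilityMeasure Q] :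
    Cstar (fun x y : E => ‖x - y‖ ^ q) P Q ≤ multiscaleDist q P Q := by
  by_cases hS : multiscaleDist q P Q = ⊤
  · rw [hS]; exact le_top
  have hN : ∀ N : ℕ, Cstar (fun x y : E => ‖x - y‖ ^ q) P Q ≤
      2 * ENNReal.ofReal ((Module.finrank ℝ E : ℝ) ^ (q / 2) * (1 / 2) ^ N) +
        multiscaleDist q P Q := by
    intro N
    obtain ⟨γ, hγ, hbal, hcost⟩ := exists_flow hq0 hq1 P Q hS (-(N : ℤ))
    obtain ⟨ρ, hρ, hρ1, hρ2, hle⟩ := exists_coupling_of_flow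
      (c := fun p : E × E => ENNReal.ofReal (‖p.1 - p.2‖ ^ q)) (by fun_prop)
      (fun x => by simp [hq0.ne'])
      (fun x y z => by
        rw [← ENNReal.ofReal_add (by positivity) (by positivity)]
        apply ENNReal.ofReal_le_ofReal
        calc ‖x - z‖ ^ q ≤ (‖x - y‖ + ‖y - z‖) ^ q := by
              gcongr; exact norm_sub_le_norm_sub_add_norm_sub _ _ _
          _ ≤ _ := Real.rpow_add_le_add_rpow (norm_nonneg _) (norm_nonneg _) hq0.le hq1.le)
      P Q γ hbal
    refine (iInf₂_le ρ ⟨hρ, hρ1, hρ2⟩).trans (hle.trans (hcost.trans ?_))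
    rw [zpow_neg, zpow_natCast, one_div, inv_pow]
  have hlim : Filter.Tendsto (fun N : ℕ => 2 * ENNReal.ofReal
      ((Module.finrank ℝ E : ℝ) ^ (q / 2) * (1 / 2) ^ N) + multiscaleDist q P Q) Filter.atTop
      (nhds (2 * ENNReal.ofReal ((Module.finrank ℝ E : ℝ) ^ (q / 2) * 0) +
        multiscaleDist q P Q)) := by
    refine (ENNReal.Tendsto.const_mul (ENNReal.tendsto_ofReal ?_) (.inr (by simp))).add_const _
    exact (_root_.tendsto_pow_atTop_nhds_zero_of_lt_one (by norm_num) (by norm_num)).const_mul _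
  simpa using ge_of_tendsto' hlim hN

end NoiseFlow

section Embedding

variable {E : Type*} [NormedAddCommGroup E] [InnerProductSpace ℝ E] [FiniteDimensional ℝ E]
  [MeasurableSpace E] [BorelSpace E]

theorem multiscaleDist_le_Cstar [Nontrivial E] {q : ℝ} (hq0 : 0 < q) (hq1 : q < 1) (P Q : Measure E)
    [IsProbabilityMeasure P] [IsProbabilityMeasure Q] :
    multiscaleDist q P Q ≤ ENNReal.ofReal (10 * (Module.finrank ℝ E : ℝ) ^ (q / 2) / (1 - q)) *
      Cstar (fun x y : E => ‖x - y‖ ^ q) P Q := by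
  have hK : 0 < (Module.finrank ℝ E : ℝ) ^ (q / 2) :=
    Real.rpow_pos_of_pos (by exact_mod_cast Module.finrank_pos) _
  have hr : 0 < 10 * (Module.finrank ℝ E : ℝ) ^ (q / 2) / (1 - q) :=
    div_pos (by positivity) (by linarith)
  rw [mul_comm, ← ENNReal.div_le_iff_le_mul (.inl (ENNReal.ofReal_pos.2 hr).ne')
    (.inl ENNReal.ofReal_ne_top)]
  refine le_iInf₂ fun γ hγ => ?_
  obtain ⟨_, rfl, rfl⟩ := hγ
  exact ENNReal.div_le_of_le_mul' (multiscaleDist_le_lintegral hq0 hq1 γ)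

/-- The weighted smoothings of `P` at all scales, relative to those of the Dirac mass at `0`. -/
def multiscaleFun (q : ℝ) (P : Measure E) (p : ℤ × E) : ℝ :=
  (Module.finrank ℝ E : ℝ) ^ (q / 2) * 2 ^ (p.1 + 1) *
    ((smoothed (gaussianScale q p.1) P p.2).toReal -
      (smoothed (gaussianScale q p.1) (Measure.dirac 0) p.2).toReal)

lemma measurable_multiscaleFun (q : ℝ) (P : Measure E) [SFinite P] :
    Measurable (multiscaleFun q P) :=
  measurable_from_prod_countable_right fun k => by
    have h1 := measurable_smoothed (gaussianScale q k) P
    have h2 := measurable_smoothed (gaussianScale q k) (Measure.dirac (0 : E))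
    exact Measurable.const_mul (h1.ennreal_toReal.sub h2.ennreal_toReal)
      ((Module.finrank ℝ E : ℝ) ^ (q / 2) * 2 ^ (k + 1))

lemma lintegral_multiscaleFun_sub (q : ℝ) (P Q : Measure E) [IsProbabilityMeasure P]
    [IsProbabilityMeasure Q] :
    ∫⁻ p, ‖multiscaleFun q P p - multiscaleFun q Q p‖ₑ ∂(Measure.count.prod volume) =
      multiscaleDist q P Q := by
  have hP := measurable_multiscaleFun q P
  have hQ := measurable_multiscaleFun q Q
  rw [lintegral_prod _ (by fun_prop), lintegral_count]
  unfold multiscaleDist lDist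
  congr with k
  rw [← lintegral_const_mul _ (by fun_prop)]
  congr with z
  simp only [multiscaleFun]
  rw [← mul_sub, sub_sub_sub_cancel_right, enorm_mul, Real.enorm_of_nonneg (by positivity),
    Real.enorm_eq_ofReal_abs, ← ofReal_sub_add_ofReal_sub _ _ ENNReal.toReal_nonneg
      ENNReal.toReal_nonneg, ENNReal.ofReal_toReal (smoothed_lt_top _ _ _).ne,
    ENNReal.ofReal_toReal (smoothed_lt_top _ _ _).ne]

lemma lintegral_norm_rpow_lt_top {q : ℝ} (hq0 : 0 < q) (hq1 : q < 1) {P : Measure E}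
    [IsProbabilityMeasure P]
    (hP : ∫⁻ x, ∫⁻ y, ENNReal.ofReal (‖x - y‖ ^ q) ∂P ∂P < ⊤) :
    ∫⁻ y, ENNReal.ofReal (‖y‖ ^ q) ∂P < ⊤ := by
  obtain ⟨x, hx⟩ := (ae_lt_top (Measurable.lintegral_prod_right'
    (f := fun p : E × E => ENNReal.ofReal (‖p.1 - p.2‖ ^ q)) (by fun_prop)) hP.ne).exists
  calc _ ≤ ∫⁻ y, (ENNReal.ofReal (‖x - y‖ ^ q) + ENNReal.ofReal (‖x‖ ^ q)) ∂P := by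
        refine lintegral_mono fun y => ?_
        rw [← ENNReal.ofReal_add (by positivity) (by positivity)]
        apply ENNReal.ofReal_le_ofReal
        calc ‖y‖ ^ q ≤ (‖x - y‖ + ‖x‖) ^ q := by
              gcongr
              rw [norm_sub_rev]
              simpa using norm_add_le (y - x) x
          _ ≤ _ := Real.rpow_add_le_add_rpow (norm_nonneg _) (norm_nonneg _) hq0.le hq1.le
    _ < ⊤ := by
        rw [lintegral_add_right _ measurable_const, lintegral_const, measure_univ, mul_one]
        exact ENNReal.add_lt_top.2 ⟨hx, ENNReal.ofReal_lt_top⟩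

lemma lintegral_multiscaleFun_lt_top {q : ℝ} (hq0 : 0 < q) (hq1 : q < 1) {P : Measure E}
    [IsProbabilityMeasure P]
    (hP : ∫⁻ x, ∫⁻ y, ENNReal.ofReal (‖x - y‖ ^ q) ∂P ∂P < ⊤) :
    ∫⁻ p, ‖multiscaleFun q P p‖ₑ ∂(Measure.count.prod volume) < ⊤ := by
  have h := lintegral_multiscaleFun_sub q P (Measure.dirac (0 : E))
  have h0 : ∀ p, multiscaleFun q (Measure.dirac (0 : E)) p = 0 := fun p => by
    simp [multiscaleFun]
  simp only [h0, sub_zero] at h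
  have h1 := multiscaleDist_le_lintegral hq0 hq1 (P.map fun x => (x, (0 : E)))
  rw [Measure.map_map measurable_fst (by fun_prop), Measure.map_map measurable_snd (by fun_prop),
    lintegral_map (by fun_prop) (by fun_prop)] at h1
  have h2 : P.map (Prod.fst ∘ fun x => (x, (0 : E))) = P := Measure.map_id
  have h3 : P.map (Prod.snd ∘ fun x => (x, (0 : E))) = Measure.dirac 0 := by
    change P.map (fun _ => 0) = _
    simp
  rw [h2, h3] at h1
  rw [h]
  refine h1.trans_lt (ENNReal.mul_lt_top ENNReal.ofReal_lt_top ?_)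
  simpa using lintegral_norm_rpow_lt_top hq0 hq1 hP

end Embedding

/-- bi-Lipschitz embedding of the snowflake Wasserstein space into
`L₁`. For `n ≥ 1` and `0 < q < 1`, let `P_d(ℝⁿ)` be the family of Borel probability
measures `P` on `ℝⁿ` with `∫∫ ‖x − y‖₂^q P(dx) P(dy) < ∞`, metrized by the earth
mover's distance `C*_d` for `d(x,y) = ‖x − y‖₂^q`. Then there is a map
`ζ : P_d(ℝⁿ) → L₁` and a real `r ≤ 10.55 n^{q/2}/(1 − q)` with
`C*_d(P,Q) ≤ ‖ζ(P) − ζ(Q)‖₁ ≤ r C*_d(P,Q)` for all `P, Q`; i.e., `(P_d(ℝⁿ), C*_d)`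
embeds bi-Lipschitzly into `L₁` with distortion at most `10.55 n^{q/2}/(1 − q)`. -/
theorem snowflake_wasserstein_biLipschitz_embed_L1 (n : ℕ) (hn : 1 ≤ n)
    (q : ℝ) (hq0 : 0 < q) (hq1 : q < 1) :
    ∃ (ζ : {P : ProbabilityMeasure (EuclideanSpace ℝ (Fin n)) //
          ∫⁻ x, ∫⁻ y, ENNReal.ofReal (snowflake n q x y)
              ∂(P : Measure (EuclideanSpace ℝ (Fin n)))
            ∂(P : Measure (EuclideanSpace ℝ (Fin n))) < ⊤} → LOne)
      (r : ℝ), r ≤ 10.55 * (n : ℝ) ^ (q / 2) / (1 - q) ∧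
      ∀ P Q,
        Cstar (snowflake n q) (P.1 : Measure (EuclideanSpace ℝ (Fin n)))
            (Q.1 : Measure (EuclideanSpace ℝ (Fin n)))
          ≤ ENNReal.ofReal ‖ζ P - ζ Q‖ ∧
        ENNReal.ofReal ‖ζ P - ζ Q‖
          ≤ ENNReal.ofReal r *
            Cstar (snowflake n q) (P.1 : Measure (EuclideanSpace ℝ (Fin n)))
              (Q.1 : Measure (EuclideanSpace ℝ (Fin n))) := by
  have : NeZero n := ⟨by omega⟩
  obtain ⟨Φ, hΦ⟩ := exists_isometry_LOne
    ((Measure.count : Measure ℤ).prod (volume : Measure (EuclideanSpace ℝ (Fin n))))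
  refine ⟨fun P => Φ (multiscaleFun q P.1), 10.55 * (n : ℝ) ^ (q / 2) / (1 - q), le_rfl,
    fun P Q => ?_⟩
  rw [hΦ _ _ (measurable_multiscaleFun q _) (measurable_multiscaleFun q _)
    (lintegral_multiscaleFun_lt_top hq0 hq1 P.2) (lintegral_multiscaleFun_lt_top hq0 hq1 Q.2),
    lintegral_multiscaleFun_sub]
  refine ⟨Cstar_le_multiscaleDist hq0 hq1 _ _,
    (multiscaleDist_le_Cstar hq0 hq1 _ _).trans (mul_le_mul_left ?_ _)⟩
  rw [finrank_euclideanSpace_fin]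
  apply ENNReal.ofReal_le_ofReal
  gcongr
  norm_num

end
end
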